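/- arXiv:2506.03544 — 3 statements merged into one kernel-verified Lean document; each statement's English description precedes it below -/
import Mathlib

section
/- Let q_n be the number of partitions of the set {1,…,n} in which more than n/√(ln ln n) elements lie in parts of size greater than (ln n)^3. Then q_n/B_n = o(2^{−n·(ln ln n)^{1/3}}); that is, 2^{n·(ln ln n)^{1/3}} · q_n / B_n tends to 0 as n tends to infinity. -/
open Filter

/-- The Bell number: the number of partitions of `{1,…,n}`. -/
noncomputable def bellNum (n : ℕ) : ℕ :=
  Nat.card (Finpartition (Finset.univ : Finset (Fin n)))

/-- The number of partitions of `{1,…,n}` in which more than `n/√(ln ln n)` elements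
lie in parts of size greater than `(ln n)³`. -/
noncomputable def manyInBigPartsCount (n : ℕ) : ℕ :=
  Nat.card {P : Finpartition (Finset.univ : Finset (Fin n)) //
    (n : ℝ) / Real.sqrt (Real.log (Real.log n)) <
      (({x : Fin n | ∃ p ∈ P.parts, x ∈ p ∧
          (Real.log n) ^ (3 : ℕ) < (p.card : ℝ)}.ncard : ℝ))}

/-- The partitions whose big elements are exactly `S`. -/
def bigPartsEq (n : ℕ) (L : ℝ) (S : Finset (Fin n)) : Type :=
  {P : Finpartition (Finset.univ : Finset (Fin n)) // ∀ x, x ∈ S ↔ L < ((P.part x).card : ℝ)}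

instance (n : ℕ) (L : ℝ) (S : Finset (Fin n)) : Finite (bigPartsEq n L S) := by
  unfold bigPartsEq; infer_instance

lemma card_setoid_le (n : ℕ) : Nat.card (Setoid (Fin n)) ≤ bellNum n := by
  classical
  unfold bellNum
  refine Nat.card_le_card_of_injective
    (fun s : Setoid (Fin n) => Finpartition.ofSetoid s) ?_
  intro s s' h
  ext x y
  have h1 := Finpartition.mem_part_ofSetoid_iff_rel (s := s) (a := x) (b := y)
  have h2 := Finpartition.mem_part_ofSetoid_iff_rel (s := s') (a := x) (b := y)
  simp only at h
  rw [h] at h1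
  exact h1.symm.trans h2

lemma exists_label {n : ℕ} {L : ℝ} (hL : 0 < L) (S : Finset (Fin n))
    (P : Finpartition (Finset.univ : Finset (Fin n)))
    (hP : ∀ x, x ∈ S ↔ L < ((P.part x).card : ℝ)) :
    ∃ b : S → Fin ⌊(n : ℝ) / L⌋₊, ∀ x y, b x = b y ↔ P.part x = P.part y := by
  classical
  let B := P.parts.filter (fun p => L < (p.card : ℝ))
  have hB : B.card ≤ ⌊(n : ℝ) / L⌋₊ := by
    apply Nat.le_floor
    rw [le_div_iff₀ hL]
    have h1 : (B.card : ℝ) * L ≤ ∑ p ∈ B, (p.card : ℝ) := by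
      rw [← nsmul_eq_mul]
      apply Finset.card_nsmul_le_sum
      intro p hp
      exact (Finset.mem_filter.1 hp).2.le
    have h2 : ∑ p ∈ B, p.card ≤ n := by
      calc ∑ p ∈ B, p.card ≤ ∑ p ∈ P.parts, p.card :=
            Finset.sum_le_sum_of_subset (Finset.filter_subset _ _)
        _ = n := by rw [P.sum_card_parts]; simp
    have h3 : (∑ p ∈ B, (p.card : ℝ)) ≤ n := by exact_mod_cast h2
    linarith
  have he : Nonempty (B ↪ Fin ⌊(n : ℝ) / L⌋₊) := by
    apply Function.Embedding.nonempty_of_card_le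
    simpa using hB
  obtain ⟨e⟩ := he
  refine ⟨fun x => e ⟨P.part x, ?_⟩, ?_⟩
  · exact Finset.mem_filter.2 ⟨P.part_mem.2 (Finset.mem_univ _), (hP x).1 x.2⟩
  · intro x y
    simp

lemma exists_rep {n : ℕ} (t : ℕ) (hn : 0 < n) :
    ∃ c : Finset (Fin n) → Fin n, ∀ p : Finset (Fin n), p.Nonempty →
      c p ∈ p ∧ ((∃ y ∈ p, t ≤ (y : ℕ)) → t ≤ (c p : ℕ)) := by
  have : ∀ p : Finset (Fin n), ∃ z : Fin n, p.Nonempty →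
      z ∈ p ∧ ((∃ y ∈ p, t ≤ (y : ℕ)) → t ≤ (z : ℕ)) := by
    intro p
    by_cases h : ∃ y ∈ p, t ≤ (y : ℕ)
    · obtain ⟨y, hy, hy'⟩ := h
      exact ⟨y, fun _ => ⟨hy, fun _ => hy'⟩⟩
    · by_cases hp : p.Nonempty
      · obtain ⟨y, hy⟩ := hp
        exact ⟨y, fun _ => ⟨hy, fun h' => absurd h' h⟩⟩
      · exact ⟨⟨0, hn⟩, fun h' => absurd h' hp⟩
  choose c hc using this
  exact ⟨c, hc⟩

/-- Label used for the re-encoded partition. -/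
def newLabel {n t : ℕ} (ht : t ≤ n) (S : Finset (Fin n)) (σ : Fin n → Fin n) (g : S → Fin t)
    (x : Fin n) : Fin n ⊕ Fin n :=
  if (x : ℕ) < t then Sum.inl x
  else if hx : x ∈ S then Sum.inl (Fin.castLE ht (g ⟨x, hx⟩)) else Sum.inr (σ x)

/-- Data lost by the re-encoding. -/
def lostData {n t : ℕ} (ht : t ≤ n) (S : Finset (Fin n)) (σ : Fin n → Fin n) (g : S → Fin t)
    (x : Fin t) : Fin n :=
  if hx : Fin.castLE ht x ∈ S then Fin.castLE ht (g ⟨_, hx⟩) else σ (Fin.castLE ht x)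

lemma part_eq_iff {n : ℕ} (P : Finpartition (Finset.univ : Finset (Fin n))) (x y : Fin n) :
    P.part x = P.part y ↔ y ∈ P.part x := by
  constructor
  · intro h
    rw [h]; exact P.mem_part (Finset.mem_univ _)
  · intro h
    exact (P.part_eq_of_mem (P.part_mem.2 (Finset.mem_univ _)) h).symm

/-- The partition off `S` is recovered from `newLabel` and `lostData`. -/
lemma recover {n t : ℕ} (ht : t ≤ n) (S : Finset (Fin n)) (c : Finset (Fin n) → Fin n)
    (hc : ∀ p : Finset (Fin n), p.Nonempty →
      c p ∈ p ∧ ((∃ y ∈ p, t ≤ (y : ℕ)) → t ≤ (c p : ℕ)))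
    (P : Finpartition (Finset.univ : Finset (Fin n)))
    (hP : ∀ x y, P.part x = P.part y → x ∈ S → y ∈ S) (g : S → Fin t)
    (ρ : Fin n → Fin n)
    (hρ : ∀ x, ρ x = if h : (x : ℕ) < t then
      lostData ht S (fun x => c (P.part x)) g ⟨x, h⟩ else x)
    (x y : Fin n) (hx : x ∉ S) (hy : y ∉ S) :
    P.part x = P.part y ↔ (ρ x = ρ y ∨ (t ≤ (ρ x : ℕ) ∧ t ≤ (ρ y : ℕ) ∧
      newLabel ht S (fun x => c (P.part x)) g (ρ x) =
      newLabel ht S (fun x => c (P.part x)) g (ρ y))) := by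
  have hne : ∀ x, (P.part x).Nonempty := fun x => ⟨x, P.mem_part (Finset.mem_univ _)⟩
  have hρ' : ∀ x, x ∉ S → ρ x = if (x : ℕ) < t then c (P.part x) else x := by
    intro x hx
    rw [hρ]
    split_ifs with h
    · unfold lostData
      rw [dif_neg (by simpa using hx)]
      simp
    · rfl
  have hcm : ∀ x, P.part (c (P.part x)) = P.part x := fun x =>
    ((part_eq_iff P _ _).2 (hc _ (hne x)).1).symm
  have hPρ : ∀ x, x ∉ S → P.part (ρ x) = P.part x := by
    intro x hx
    rw [hρ' x hx]
    split_ifs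
    · exact hcm x
    · rfl
  have hSρ : ∀ x, x ∉ S → ρ x ∉ S := fun x hx h => hx (hP _ _ (hPρ x hx) h)
  constructor
  · intro h
    by_cases h1 : t ≤ (ρ x : ℕ)
    · right
      have h2 : t ≤ (ρ y : ℕ) := by
        rw [hρ' y hy]
        split_ifs with h3
        · apply (hc _ (hne y)).2
          exact ⟨ρ x, (part_eq_iff P _ _).1 (by rw [hPρ x hx, h]), h1⟩
        · omega
      refine ⟨h1, h2, ?_⟩
      unfold newLabel
      rw [if_neg (by omega), if_neg (by omega), dif_neg (hSρ x hx), dif_neg (hSρ y hy)]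
      simp only [hPρ x hx, hPρ y hy, h]
    · left
      have h3 : (x : ℕ) < t := by
        by_contra h3
        rw [hρ' x hx, if_neg h3] at h1
        omega
      rw [hρ' x hx, if_pos h3] at h1 ⊢
      have h4 : (y : ℕ) < t := by
        by_contra h4
        exact h1 ((hc _ (hne x)).2 ⟨y, (part_eq_iff P _ _).1 h, by omega⟩)
      rw [hρ' y hy, if_pos h4, h]
  · rintro (h | ⟨h1, h2, h⟩)
    · rw [← hPρ x hx, ← hPρ y hy, h]
    · unfold newLabel at h
      rw [if_neg (by omega), if_neg (by omega), dif_neg (hSρ x hx), dif_neg (hSρ y hy)] at h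
      have h' : c (P.part (ρ x)) = c (P.part (ρ y)) := Sum.inr.inj h
      rw [← hPρ x hx, ← hPρ y hy, ← hcm (ρ x), ← hcm (ρ y), h']

lemma card_fixed {n t : ℕ} (hn : 0 < n) (ht : t ≤ n) {L : ℝ} (hL : 0 < L) (S : Finset (Fin n)) :
    Nat.card (bigPartsEq n L S) * t ^ S.card ≤
      bellNum n * n ^ t * ⌊(n : ℝ) / L⌋₊ ^ S.card := by
  classical
  obtain ⟨c, hc⟩ := exists_rep t hn
  choose b hb using fun P : bigPartsEq n L S => exists_label hL S P.1 P.2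
  let F : bigPartsEq n L S × (S → Fin t) →
      (Setoid (Fin n) × (Fin t → Fin n)) × (S → Fin ⌊(n : ℝ) / L⌋₊) := fun q =>
    ((Setoid.ker (newLabel ht S (fun x => c (q.1.1.part x)) q.2),
      lostData ht S (fun x => c (q.1.1.part x)) q.2), b q.1)
  have hF : Function.Injective F := by
    rintro ⟨P, g⟩ ⟨P', g'⟩ h
    simp only [F, Prod.mk.injEq] at h
    obtain ⟨⟨h1, h2⟩, h3⟩ := h
    have h1' : ∀ x y, newLabel ht S (fun x => c (P.1.part x)) g x =
        newLabel ht S (fun x => c (P.1.part x)) g y ↔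
        newLabel ht S (fun x => c (P'.1.part x)) g' x =
        newLabel ht S (fun x => c (P'.1.part x)) g' y := by
      intro x y
      have := congrArg (fun s : Setoid (Fin n) => s x y) h1
      simpa [Setoid.ker_def] using this
    have hsat : ∀ P : bigPartsEq n L S, ∀ x y, P.1.part x = P.1.part y → x ∈ S → y ∈ S := by
      intro P x y h hx
      rw [P.2] at hx ⊢
      rwa [← h]
    have hg : g = g' := by
      funext ⟨x, hx⟩
      by_cases hxt : (x : ℕ) < t
      · have := congrFun h2 ⟨x, hxt⟩
        unfold lostData at this
        rw [dif_pos (by simpa using hx), dif_pos (by simpa using hx)] at this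
        simpa [Fin.ext_iff] using this
      · have := (h1' x (Fin.castLE ht (g ⟨x, hx⟩))).1 (by
          unfold newLabel
          rw [if_neg hxt, dif_pos hx, if_pos (by simp)])
        unfold newLabel at this
        rw [if_neg hxt, dif_pos hx, if_pos (by simp)] at this
        have := Sum.inl.inj this
        simpa [Fin.ext_iff, eq_comm] using this
    have hpart : ∀ x y, P.1.part x = P.1.part y ↔ P'.1.part x = P'.1.part y := by
      intro x y
      by_cases hx : x ∈ S
      · by_cases hy : y ∈ S
        · have e1 := hb P ⟨x, hx⟩ ⟨y, hy⟩
          have e2 := hb P' ⟨x, hx⟩ ⟨y, hy⟩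
          rw [h3] at e1
          exact e1.symm.trans e2
        · exact ⟨fun h => absurd (hsat P x y h hx) hy, fun h => absurd (hsat P' x y h hx) hy⟩
      · by_cases hy : y ∈ S
        · exact ⟨fun h => absurd (hsat P y x h.symm hy) hx,
            fun h => absurd (hsat P' y x h.symm hy) hx⟩
        · have r1 := recover ht S c hc P.1 (hsat P) g _ (fun _ => rfl) x y hx hy
          have r2 := recover ht S c hc P'.1 (hsat P') g' _ (fun _ => rfl) x y hx hy
          rw [r1, r2]
          simp only [h2, h1']
    have hPP : P = P' := by
      apply Subtype.ext
      have hp : ∀ x, P.1.part x = P'.1.part x := by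
        intro x
        ext y
        rw [← part_eq_iff, ← part_eq_iff, hpart]
      have key : ∀ A B : Finpartition (Finset.univ : Finset (Fin n)),
          (∀ x, A.part x = B.part x) → A.parts ⊆ B.parts := by
        intro A B h p hp
        obtain ⟨x, hx⟩ := A.nonempty_of_mem_parts hp
        rw [← A.part_eq_of_mem hp hx, h]
        exact B.part_mem.2 (Finset.mem_univ _)
      exact Finpartition.ext (Finset.Subset.antisymm (key _ _ hp) (key _ _ fun x => (hp x).symm))
    rw [hPP, hg]
  have hfin : Finite (Setoid (Fin n)) := by
    refine Finite.of_injective (fun s : Setoid (Fin n) => (fun x y => s x y)) ?_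
    intro s s' h
    ext x y
    exact iff_of_eq (congrFun (congrFun h x) y)
  have := Nat.card_le_card_of_injective F hF
  simp only [Nat.card_prod, Nat.card_fun, Nat.card_eq_fintype_card (α := Fin _),
    Nat.card_eq_fintype_card (α := {x // x ∈ S}), Fintype.card_fin, Fintype.card_coe] at this
  refine this.trans ?_
  gcongr
  exact card_setoid_le n

lemma count_le {n : ℕ} {C : ℝ} (hC : 0 ≤ C) (h : ∀ S : Finset (Fin n),
      (n : ℝ) / Real.sqrt (Real.log (Real.log n)) < (S.card : ℝ) →
      (Nat.card (bigPartsEq n ((Real.log n) ^ (3 : ℕ)) S) : ℝ) ≤ C) :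
    (manyInBigPartsCount n : ℝ) ≤ 2 ^ n * C := by
  classical
  let U := {S : Finset (Fin n) // (n : ℝ) / Real.sqrt (Real.log (Real.log n)) < (S.card : ℝ)}
  have h1 : manyInBigPartsCount n ≤
      Nat.card (Σ S : U, bigPartsEq n ((Real.log n) ^ (3 : ℕ)) S.1) := by
    unfold manyInBigPartsCount
    have hs : ∀ P : Finpartition (Finset.univ : Finset (Fin n)),
      {x : Fin n | ∃ p ∈ P.parts, x ∈ p ∧ (Real.log n) ^ (3 : ℕ) < (p.card : ℝ)} =
      ((Finset.univ.filter fun x => (Real.log n) ^ (3 : ℕ) < ((P.part x).card : ℝ) : Finset (Fin n)) : Set (Fin n)) := by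
      intro P
      ext x
      simp only [Set.mem_ofPred_eq, Finset.coe_filter, Finset.mem_univ, true_and]
      constructor
      · rintro ⟨p, hp, hx, h⟩
        rwa [P.part_eq_of_mem hp hx]
      · intro h
        exact ⟨_, P.part_mem.2 (Finset.mem_univ x), P.mem_part (Finset.mem_univ _), h⟩
    refine Nat.card_le_card_of_injective (fun P => ⟨⟨Finset.univ.filter fun x =>
      (Real.log n) ^ (3 : ℕ) < ((P.1.part x).card : ℝ), ?_⟩, ⟨P.1, ?_⟩⟩) ?_
    · have := P.2
      rwa [hs, Set.ncard_coe_finset] at this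
    · intro x; simp
    · intro P P' h
      have := congrArg (fun z : (Σ S : U, bigPartsEq n ((Real.log n) ^ (3 : ℕ)) S.1) => z.2.1) h
      exact Subtype.ext this
  rw [Nat.card_sigma] at h1
  calc (manyInBigPartsCount n : ℝ)
      ≤ ∑ S : U, (Nat.card (bigPartsEq n ((Real.log n) ^ (3 : ℕ)) S.1) : ℝ) := by
        exact_mod_cast h1
    _ ≤ ∑ S : U, C := Finset.sum_le_sum fun S _ => h S.1 S.2
    _ = (Fintype.card U : ℝ) * C := by simp
    _ ≤ 2 ^ n * C := by
        gcongr
        have : Fintype.card U ≤ 2 ^ n := by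
          refine (Fintype.card_subtype_le _).trans ?_
          simp
        exact_mod_cast this

lemma main_bound {n : ℕ} (hl : 1 < Real.log (Real.log n)) :
    (2 : ℝ) ^ ((n : ℝ) * (Real.log (Real.log n)) ^ ((1 : ℝ) / 3)) *
          (manyInBigPartsCount n : ℝ) / (bellNum n : ℝ) ≤
    Real.exp (n * ((Real.log (Real.log n)) ^ ((1 : ℝ) / 3) + 3 -
      Real.sqrt (Real.log (Real.log n)))) := by
  set s := Real.log (Real.log n) with hs
  set L := Real.log n with hL
  have hL1 : 1 < L := by
    by_contra h
    have h0 : 0 ≤ L := Real.log_natCast_nonneg n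
    have := Real.log_nonpos h0 (not_lt.1 h)
    linarith
  have hn : 0 < n := by
    rcases Nat.eq_zero_or_pos n with h | h
    · rw [h] at hL; simp at hL; linarith
    · exact h
  have hn' : (0 : ℝ) < n := by exact_mod_cast hn
  have hLn : L ≤ n := (Real.log_le_sub_one_of_pos hn').trans (by linarith)
  have hL0 : 0 < L := by linarith
  have hLexp : Real.exp s = L := Real.exp_log hL0
  have hnexp : Real.exp L = n := Real.exp_log hn'
  have hs0 : 0 < Real.sqrt s := Real.sqrt_pos.2 (by linarith)
  set t := ⌈(n : ℝ) / L ^ 2⌉₊ with ht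
  have htn : t ≤ n := by
    apply Nat.ceil_le.2
    apply div_le_self hn'.le
    nlinarith
  have ht1 : (n : ℝ) / L ^ 2 ≤ t := Nat.le_ceil _
  have ht0 : (0 : ℝ) < t := lt_of_lt_of_le (by positivity) ht1
  have ht2 : (t : ℝ) * L ≤ 2 * n := by
    have : (t : ℝ) < n / L ^ 2 + 1 := Nat.ceil_lt_add_one (by positivity)
    have h2 : (n / L ^ 2) * L ≤ n := by
      rw [div_mul_eq_mul_div, div_le_iff₀ (by positivity)]
      nlinarith [mul_pos hn' hL0]
    nlinarith
  have hB : (0 : ℝ) < bellNum n := by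
    have : 0 < bellNum n := by
      unfold bellNum
      exact Nat.card_pos
    exact_mod_cast this
  have hcount := count_le (n := n)
    (C := bellNum n * Real.exp (2 * n) * Real.exp (- (n * Real.sqrt s))) (by positivity) (by
    intro S hS
    have h1 := card_fixed hn htn (L := L ^ 3) (by positivity) S
    have h1' : (Nat.card (bigPartsEq n (L ^ 3) S) : ℝ) * (t : ℝ) ^ S.card ≤
      bellNum n * (n : ℝ) ^ t * (⌊(n : ℝ) / L ^ 3⌋₊ : ℝ) ^ S.card := by exact_mod_cast h1
    have hk : (⌊(n : ℝ) / L ^ 3⌋₊ : ℝ) ≤ Real.exp (-s) * t := by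
      refine (Nat.floor_le (by positivity)).trans ?_
      rw [Real.exp_neg, hLexp]
      calc (n : ℝ) / L ^ 3 = L⁻¹ * (n / L ^ 2) := by field_simp
        _ ≤ _ := by gcongr
    have hnt : (n : ℝ) ^ t ≤ Real.exp (2 * n) := by
      rw [← hnexp, ← Real.exp_nat_mul, hnexp]
      exact Real.exp_le_exp.2 ht2
    have hss : n * Real.sqrt s ≤ S.card * s := by
      rw [← hs, div_lt_iff₀ hs0] at hS
      calc n * Real.sqrt s ≤ (S.card * Real.sqrt s) * Real.sqrt s := by gcongr
        _ = S.card * s := by rw [mul_assoc, Real.mul_self_sqrt (by linarith)]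
    have hks : (⌊(n : ℝ) / L ^ 3⌋₊ : ℝ) ^ S.card ≤
        Real.exp (- (n * Real.sqrt s)) * (t : ℝ) ^ S.card := by
      calc (⌊(n : ℝ) / L ^ 3⌋₊ : ℝ) ^ S.card ≤ (Real.exp (-s) * t) ^ S.card := by gcongr
        _ = Real.exp (S.card * (-s)) * (t : ℝ) ^ S.card := by
          rw [mul_pow, ← Real.exp_nat_mul]
        _ ≤ _ := by
          gcongr
          linarith
    refine le_of_mul_le_mul_right ?_ (pow_pos ht0 S.card)
    refine h1'.trans ?_
    calc _ ≤ bellNum n * Real.exp (2 * n) *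
          (Real.exp (- (n * Real.sqrt s)) * (t : ℝ) ^ S.card) := by gcongr
      _ = _ := by ring)
  rw [div_le_iff₀ hB]
  have hl2 : Real.log 2 ≤ 1 := by linarith [Real.log_two_lt_d9]
  have h2 : (2 : ℝ) ^ ((n : ℝ) * s ^ ((1 : ℝ) / 3)) ≤ Real.exp (n * s ^ ((1 : ℝ) / 3)) := by
    rw [Real.rpow_def_of_pos (by norm_num)]
    apply Real.exp_le_exp.2
    have : 0 ≤ (n : ℝ) * s ^ ((1 : ℝ) / 3) := by
      have : 0 ≤ s := by linarith
      positivity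
    nlinarith
  have h3 : (2 : ℝ) ^ n ≤ Real.exp n := by
    have : (2 : ℝ) ≤ Real.exp 1 := by linarith [Real.exp_one_gt_d9]
    calc (2 : ℝ) ^ n ≤ (Real.exp 1) ^ n := by gcongr
      _ = Real.exp n := by rw [← Real.exp_nat_mul, mul_one]
  calc _ ≤ Real.exp (n * s ^ ((1 : ℝ) / 3)) * (Real.exp n *
        (bellNum n * Real.exp (2 * n) * Real.exp (- (n * Real.sqrt s)))) := by
        refine mul_le_mul h2 (hcount.trans ?_) (by positivity) (by positivity)
        gcongr
    _ = (Real.exp (n * s ^ ((1 : ℝ) / 3)) * Real.exp n * Real.exp (2 * n) *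
        Real.exp (- (n * Real.sqrt s))) * bellNum n := by ring
    _ = _ := by
        rw [← Real.exp_add, ← Real.exp_add, ← Real.exp_add]
        congr 2
        ring

/-- The proportion of partitions of `{1,…,n}` with more than `n/√(ln ln n)` elements
in parts of size greater than `(ln n)³` is `o(2^{-n (ln ln n)^{1/3}})`. -/
theorem stmt_17 :
    Tendsto
      (fun n : ℕ =>
        (2 : ℝ) ^ ((n : ℝ) * (Real.log (Real.log n)) ^ ((1 : ℝ) / 3)) *
          (manyInBigPartsCount n : ℝ) / (bellNum n : ℝ))
      atTop (nhds 0) := by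
  have hs : Tendsto (fun n : ℕ => Real.log (Real.log n)) atTop atTop :=
    Real.tendsto_log_atTop.comp (Real.tendsto_log_atTop.comp tendsto_natCast_atTop_atTop)
  have h6 : Tendsto (fun n : ℕ => (Real.log (Real.log n)) ^ ((1 : ℝ) / 6)) atTop atTop :=
    (tendsto_rpow_atTop (by norm_num)).comp hs
  have hlim : Tendsto (fun n : ℕ => Real.exp (-(n : ℝ))) atTop (nhds 0) :=
    Real.tendsto_exp_neg_atTop_nhds_zero.comp tendsto_natCast_atTop_atTop
  refine tendsto_of_tendsto_of_tendsto_of_le_of_le' tendsto_const_nhds hlim ?_ ?_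
  · filter_upwards with n
    positivity
  · filter_upwards [hs.eventually_gt_atTop 1, h6.eventually_ge_atTop 3] with n h1 h2
    refine (main_bound h1).trans (Real.exp_le_exp.2 ?_)
    have hs0 : 0 ≤ Real.log (Real.log n) := by linarith
    set u := (Real.log (Real.log n)) ^ ((1 : ℝ) / 6) with hu
    have e1 : (Real.log (Real.log n)) ^ ((1 : ℝ) / 3) = u ^ 2 := by
      rw [hu, ← Real.rpow_natCast, ← Real.rpow_mul hs0]; norm_num
    have e2 : Real.sqrt (Real.log (Real.log n)) = u ^ 3 := by
      rw [hu, ← Real.rpow_natCast, ← Real.rpow_mul hs0, Real.sqrt_eq_rpow]; norm_num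
    rw [e1, e2]
    have h3 : u ^ 2 + 3 - u ^ 3 ≤ -1 := by nlinarith [sq_nonneg u, mul_nonneg (sq_nonneg u) (sub_nonneg.2 h2)]
    have : (0 : ℝ) ≤ n := Nat.cast_nonneg n
    nlinarith
end

section
/- There is n_0 such that for all n ≥ n_0 and each i ∈ {1, 2, 3}, we have n·f*_i(n)/(16·log_2 n) ≤ f*_i(n+1) ≤ 4n·f*_i(n). -/
open SimpleGraph

/-- `H` is a star: some center vertex is adjacent to all other vertices, and there
are no further edges.  One- and two-vertex stars are allowed. -/
def IsStarGraph {V : Type*} (H : SimpleGraph V) : Prop :=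
  ∃ c : V, ∀ a b : V, H.Adj a b ↔ a ≠ b ∧ (a = c ∨ b = c)

/-- `H` is a triangle `K₃`. -/
def IsTriangleGraph {V : Type*} (H : SimpleGraph V) : Prop :=
  Nonempty (H ≃g (⊤ : SimpleGraph (Fin 3)))

/-- Every connected component of `H` is a star or a triangle. -/
def StarsAndTriangles {V : Type*} (H : SimpleGraph V) : Prop :=
  ∀ c : H.ConnectedComponent,
    IsStarGraph (H.induce c.supp) ∨ IsTriangleGraph (H.induce c.supp)

/-- Every connected component of `H` is a star or a complete graph. -/
def StarsAndCliques {V : Type*} (H : SimpleGraph V) : Prop :=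
  ∀ c : H.ConnectedComponent,
    IsStarGraph (H.induce c.supp) ∨ H.induce c.supp = ⊤

/-- `H` is the join of a clique and a stable set (either part may be empty). -/
def CliqueJoinStable {V : Type*} (H : SimpleGraph V) : Prop :=
  ∃ K : Set V,
    (∀ a ∈ K, ∀ b ∈ K, a ≠ b → H.Adj a b) ∧
    (∀ a, a ∉ K → ∀ b, b ∉ K → ¬ H.Adj a b) ∧
    (∀ a ∈ K, ∀ b, b ∉ K → H.Adj a b)

/-- Every connected component of `H` is the join of a clique and a stable set. -/
def ComponentsCliqueJoinStable {V : Type*} (H : SimpleGraph V) : Prop :=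
  ∀ c : H.ConnectedComponent, CliqueJoinStable (H.induce c.supp)

/-- `f*₁(n)`: the number of graphs on `{1,…,n}` whose complement is a disjoint union
of stars and triangles. -/
noncomputable def fstar1 (n : ℕ) : ℕ :=
  {G : SimpleGraph (Fin n) | StarsAndTriangles Gᶜ}.ncard

/-- `f*₂(n)`: the number of graphs on `{1,…,n}` whose complement is a disjoint union
of stars and complete graphs. -/
noncomputable def fstar2 (n : ℕ) : ℕ :=
  {G : SimpleGraph (Fin n) | StarsAndCliques Gᶜ}.ncard

/-- `f*₃(n)`: the number of graphs on `{1,…,n}` such that every component of the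
complement is the join of a clique and a stable set. -/
noncomputable def fstar3 (n : ℕ) : ℕ :=
  {G : SimpleGraph (Fin n) | ComponentsCliqueJoinStable Gᶜ}.ncard


/-- The graph given by a labelling `g` and a marking `K`. -/
def mkG {V α : Type} (g : V → α) (K : V → Prop) : SimpleGraph V where
  Adj a b := a ≠ b ∧ g a = g b ∧ (K a ∨ K b)
  symm := ⟨fun _ _ h => ⟨h.1.symm, h.2.1.symm, h.2.2.symm⟩⟩
  loopless := ⟨fun _ h => h.1 rfl⟩

/-- Side condition on a labelling and a marking for the class number `i`. -/
def Qc (i : ℕ) {V α : Type} (g : V → α) (K : V → Prop) : Prop :=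
  ∀ a b, K a → K b → a ≠ b → g a = g b →
    (i ≤ 2 → ∀ c, g c = g a → K c) ∧
    (i ≤ 1 → ∃ t, ∀ c, g c = g a → c = a ∨ c = b ∨ c = t)

/-- `g, K` represent the graph `H` in class `i`. -/
def GRep (i : ℕ) {V α : Type} (H : SimpleGraph V) (g : V → α) (K : V → Prop) : Prop :=
  (∀ a b, H.Adj a b ↔ a ≠ b ∧ g a = g b ∧ (K a ∨ K b)) ∧ Qc i g K

/-- Graphs with a representation in class `i`. -/
def cls (i n : ℕ) : Set (SimpleGraph (Fin n)) :=
  {H | ∃ (α : Type) (g : Fin n → α) (K : Fin n → Prop), GRep i H g K}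

/-- Local form of a representation. -/
def Loc (i : ℕ) {V : Type} (H : SimpleGraph V) (s : Set V) (K : V → Prop) : Prop :=
  (∀ a ∈ s, ∀ b ∈ s, (H.Adj a b ↔ a ≠ b ∧ (K a ∨ K b))) ∧
  ∀ a ∈ s, ∀ b ∈ s, K a → K b → a ≠ b →
    (i ≤ 2 → ∀ c ∈ s, K c) ∧ (i ≤ 1 → ∃ t, ∀ c ∈ s, c = a ∨ c = b ∨ c = t)

lemma strong_of_loc (i : ℕ) {V : Type} (H : SimpleGraph V)
    (h : ∀ c : H.ConnectedComponent, ∃ K, Loc i H c.supp K) :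
    ∃ K, GRep i H H.connectedComponentMk K := by
  choose K hK using h
  refine ⟨fun x => K (H.connectedComponentMk x) x, ?_, ?_⟩
  · intro a b
    constructor
    · intro hab
      have e : H.connectedComponentMk a = H.connectedComponentMk b :=
        ConnectedComponent.sound hab.reachable
      refine ⟨hab.ne, e, ?_⟩
      have := ((hK (H.connectedComponentMk a)).1 a rfl b e.symm).1 hab
      beta_reduce
      rw [← e]
      exact this.2
    · rintro ⟨h1, e, h2⟩
      beta_reduce at h2
      rw [← e] at h2
      exact ((hK (H.connectedComponentMk a)).1 a rfl b e.symm).2 ⟨h1, h2⟩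
  · intro a b ha hb hab e
    rw [← e] at hb
    obtain ⟨h1, h2⟩ := (hK (H.connectedComponentMk a)).2 a rfl b e.symm ha hb hab
    refine ⟨fun hi c hc => ?_, fun hi => ?_⟩
    · beta_reduce
      rw [hc]
      exact h1 hi c hc
    · obtain ⟨t, ht⟩ := h2 hi
      exact ⟨t, fun c hc => ht c hc⟩

lemma loc_star (i : ℕ) {V : Type} (H : SimpleGraph V) (s : Set V)
    (h : IsStarGraph (H.induce s)) : ∃ K, Loc i H s K := by
  obtain ⟨⟨c, hc⟩, h⟩ := h
  refine ⟨fun x => x = c, fun a ha b hb => ?_, ?_⟩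
  · have := h ⟨a, ha⟩ ⟨b, hb⟩
    simpa [Subtype.ext_iff] using this
  · rintro a ha b hb rfl rfl hab
    exact absurd rfl hab

lemma loc_join {V : Type} (H : SimpleGraph V) (s : Set V)
    (h : CliqueJoinStable (H.induce s)) : ∃ K, Loc 3 H s K := by
  obtain ⟨K, h1, h2, h3⟩ := h
  refine ⟨fun x => ∃ hx : x ∈ s, (⟨x, hx⟩ : s) ∈ K, fun a ha b hb => ?_, ?_⟩
  · have h1' := h1 ⟨a, ha⟩
    have h2' := h2 ⟨a, ha⟩
    have h3' := h3 ⟨a, ha⟩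
    have h3'' := h3 ⟨b, hb⟩
    have e1 : (∃ hx : a ∈ s, (⟨a, hx⟩ : s) ∈ K) ↔ (⟨a, ha⟩ : s) ∈ K := ⟨fun ⟨_, h⟩ => h, fun h => ⟨_, h⟩⟩
    have e2 : (∃ hx : b ∈ s, (⟨b, hx⟩ : s) ∈ K) ↔ (⟨b, hb⟩ : s) ∈ K := ⟨fun ⟨_, h⟩ => h, fun h => ⟨_, h⟩⟩
    simp only [e1, e2]
    constructor
    · intro hab
      refine ⟨hab.ne, ?_⟩
      by_contra hcon
      push Not at hcon
      exact h2' hcon.1 ⟨b, hb⟩ hcon.2 hab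
    · rintro ⟨hab, h⟩
      have hne : (⟨a, ha⟩ : s) ≠ ⟨b, hb⟩ := fun h => hab (congrArg Subtype.val h)
      by_cases ka : (⟨a, ha⟩ : s) ∈ K <;> by_cases kb : (⟨b, hb⟩ : s) ∈ K
      · exact h1' ka _ kb hne
      · exact h3' ka _ kb
      · exact (h3'' kb _ ka).symm
      · tauto
  · intro a ha b hb _ _ _
    exact ⟨fun h => by omega, fun h => by omega⟩

lemma loc_top {V : Type} (H : SimpleGraph V) (s : Set V)
    (h : H.induce s = ⊤) : ∃ K, Loc 2 H s K := by
  refine ⟨fun _ => True, fun a ha b hb => ?_, ?_⟩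
  · have : (H.induce s).Adj ⟨a, ha⟩ ⟨b, hb⟩ ↔ (⟨a, ha⟩ : s) ≠ ⟨b, hb⟩ := by
      rw [h]; exact SimpleGraph.top_adj _ _
    simpa [Subtype.ext_iff] using this
  · intro a ha b hb _ _ _
    exact ⟨fun h => by simp, fun h => by omega⟩

lemma loc_tri {V : Type} (H : SimpleGraph V) (s : Set V)
    (h : IsTriangleGraph (H.induce s)) : ∃ K, Loc 1 H s K := by
  obtain ⟨e⟩ := h
  refine ⟨fun _ => True, fun a ha b hb => ?_, ?_⟩
  · have : (H.induce s).Adj ⟨a, ha⟩ ⟨b, hb⟩ ↔ _ := e.map_adj_iff.symm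
    simpa [Subtype.ext_iff] using this
  · intro a ha b hb _ _ hab
    refine ⟨fun h => by simp, fun _ => ?_⟩
    have key : ∀ x y : Fin 3, x ≠ y → ∃ t, ∀ z, z = x ∨ z = y ∨ z = t := by decide
    obtain ⟨t, ht⟩ := key (e ⟨a, ha⟩) (e ⟨b, hb⟩) (by
      intro h
      exact hab (congrArg Subtype.val (e.injective h)))
    refine ⟨e.symm t, fun c hc => ?_⟩
    rcases ht (e ⟨c, hc⟩) with h | h | h
    · exact Or.inl (congrArg Subtype.val (e.injective h))
    · exact Or.inr (Or.inl (congrArg Subtype.val (e.injective h)))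
    · right; right
      rw [← h]; simp

lemma rep_reach {i : ℕ} {V α : Type} {H : SimpleGraph V} {g : V → α} {K : V → Prop}
    (h : GRep i H g K) {a b : V} (hr : H.Reachable a b) : g a = g b := by
  obtain ⟨w⟩ := hr
  induction w with
  | nil => rfl
  | cons hadj _ ih => exact ((h.1 _ _).1 hadj).2.1.trans ih

lemma comp_g {i : ℕ} {V α : Type} {H : SimpleGraph V} {g : V → α} {K : V → Prop}
    (h : GRep i H g K) (c : H.ConnectedComponent) {a b : V} (ha : a ∈ c.supp) (hb : b ∈ c.supp) :
    g a = g b := by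
  apply rep_reach h
  apply ConnectedComponent.exact
  exact Eq.trans ha (Eq.symm hb)

lemma comp_mem {i : ℕ} {V α : Type} {H : SimpleGraph V} {g : V → α} {K : V → Prop}
    (h : GRep i H g K) (c : H.ConnectedComponent) {a b : V} (ha : a ∈ c.supp) (hK : K a)
    (e : g b = g a) : b ∈ c.supp := by
  by_cases hab : b = a
  · rwa [hab]
  · have : H.Adj b a := (h.1 b a).2 ⟨hab, e, Or.inr hK⟩
    exact (ConnectedComponent.sound this.reachable).trans ha

lemma comp_single {i : ℕ} {V α : Type} {H : SimpleGraph V} {g : V → α} {K : V → Prop}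
    (h : GRep i H g K) (c : H.ConnectedComponent) {a b : V} (ha : a ∈ c.supp) (hb : b ∈ c.supp)
    (hK : ∀ x ∈ c.supp, ¬ K x) : a = b := by
  have hr : H.Reachable a b := ConnectedComponent.exact (Eq.trans ha (Eq.symm hb))
  obtain ⟨w⟩ := hr
  cases w with
  | nil => rfl
  | cons hadj p =>
    exfalso
    have hm := (ConnectedComponent.sound hadj.reachable).symm.trans ha
    rcases ((h.1 _ _).1 hadj).2.2 with h' | h'
    · exact hK _ ha h'
    · exact hK _ hm h'

lemma join_of_rep {i : ℕ} {V α : Type} {H : SimpleGraph V} {g : V → α} {K : V → Prop}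
    (h : GRep i H g K) : ComponentsCliqueJoinStable H := by
  intro c
  refine ⟨{x | K x.1}, ?_, ?_, ?_⟩
  · rintro ⟨a, ha⟩ hKa ⟨b, hb⟩ hKb hab
    exact (h.1 a b).2 ⟨fun h => hab (Subtype.ext h), comp_g h c ha hb, Or.inl hKa⟩
  · rintro ⟨a, ha⟩ hKa ⟨b, hb⟩ hKb hab
    have := (h.1 a b).1 hab
    exact this.2.2.elim hKa hKb
  · rintro ⟨a, ha⟩ hKa ⟨b, hb⟩ hKb
    refine (h.1 a b).2 ⟨?_, comp_g h c ha hb, Or.inl hKa⟩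
    rintro rfl
    exact hKb hKa

lemma star_or {i : ℕ} {V α : Type} {H : SimpleGraph V} {g : V → α} {K : V → Prop}
    (h : GRep i H g K) (c : H.ConnectedComponent) :
    IsStarGraph (H.induce c.supp) ∨ ∃ a ∈ c.supp, ∃ b ∈ c.supp, K a ∧ K b ∧ a ≠ b := by
  by_cases h2 : ∃ a ∈ c.supp, ∃ b ∈ c.supp, K a ∧ K b ∧ a ≠ b
  · exact Or.inr h2
  left
  push Not at h2
  by_cases h1 : ∃ a ∈ c.supp, K a
  · obtain ⟨k, hk, hKk⟩ := h1
    refine ⟨⟨k, hk⟩, ?_⟩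
    rintro ⟨a, ha⟩ ⟨b, hb⟩
    have := h.1 a b
    have e := comp_g h c ha hb
    have e1 : K a ↔ a = k := ⟨fun h => h2 a ha k hk h hKk, fun h => h ▸ hKk⟩
    have e2 : K b ↔ b = k := ⟨fun h => h2 b hb k hk h hKk, fun h => h ▸ hKk⟩
    simp only [comap_adj, Function.Embedding.subtype_apply, ne_eq, Subtype.mk.injEq]
    rw [this, e1, e2]
    tauto
  · push Not at h1
    obtain ⟨k, hk⟩ := c.nonempty_supp
    refine ⟨⟨k, hk⟩, ?_⟩
    rintro ⟨a, ha⟩ ⟨b, hb⟩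
    have : a = b := comp_single h c ha hb h1
    subst this
    simp

lemma clique_of_rep {V α : Type} {H : SimpleGraph V} {g : V → α} {K : V → Prop} {i : ℕ}
    (hi : i ≤ 2) (h : GRep i H g K) (c : H.ConnectedComponent) {a b : V} (ha : a ∈ c.supp)
    (hb : b ∈ c.supp) (hKa : K a) (hKb : K b) (hab : a ≠ b) : H.induce c.supp = ⊤ := by
  have hQ := (h.2 a b hKa hKb hab (comp_g h c ha hb)).1 hi
  ext ⟨x, hx⟩ ⟨y, hy⟩
  simp only [comap_adj, Function.Embedding.subtype_apply, top_adj, ne_eq, Subtype.mk.injEq]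
  rw [h.1]
  have e := comp_g h c hx hy
  have := hQ x (comp_g h c hx ha)
  tauto

lemma sc_of_rep {V α : Type} {H : SimpleGraph V} {g : V → α} {K : V → Prop}
    (h : GRep 2 H g K) : StarsAndCliques H := by
  intro c
  rcases star_or h c with h' | ⟨a, ha, b, hb, hKa, hKb, hab⟩
  · exact Or.inl h'
  · exact Or.inr (clique_of_rep le_rfl h c ha hb hKa hKb hab)

lemma st_of_rep {V α : Type} {H : SimpleGraph V} {g : V → α} {K : V → Prop}
    (h : GRep 1 H g K) : StarsAndTriangles H := by
  intro c
  rcases star_or h c with h' | ⟨a, ha, b, hb, hKa, hKb, hab⟩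
  · exact Or.inl h'
  have htop := clique_of_rep (by norm_num) h c ha hb hKa hKb hab
  obtain ⟨t, ht⟩ := (h.2 a b hKa hKb hab (comp_g h c ha hb)).2 le_rfl
  by_cases hx : ∃ x ∈ c.supp, x ≠ a ∧ x ≠ b
  · right
    obtain ⟨x, hx, hxa, hxb⟩ := hx
    have hxt : x = t := by
      have := ht x (comp_g h c hx ha)
      tauto
    subst hxt
    have hs : c.supp = {a, b, x} := by
      ext y
      constructor
      · intro hy
        exact ht y (comp_g h c hy ha)
      · rintro (rfl | rfl | rfl) <;> assumption
    have hcard : Nat.card c.supp = 3 := by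
      rw [hs, Nat.card_coe_set_eq]
      exact Set.ncard_eq_three.2 ⟨a, b, x, hab, hxa.symm, hxb.symm, rfl⟩
    rw [htop]
    have : Finite c.supp := Nat.finite_of_card_ne_zero (by omega)
    exact ⟨Iso.completeGraph (Finite.equivFinOfCardEq hcard)⟩
  · left
    push Not at hx
    rw [htop]
    refine ⟨⟨a, ha⟩, ?_⟩
    rintro ⟨x, hx'⟩ ⟨y, hy'⟩
    have h1 := hx x hx'
    have h2 := hx y hy'
    simp only [top_adj, ne_eq, Subtype.mk.injEq]
    by_cases e1 : x = a <;> by_cases e2 : y = a <;> simp_all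

lemma mem_cls_strong {i n : ℕ} (hi : 1 ≤ i ∧ i ≤ 3) {H : SimpleGraph (Fin n)} (h : H ∈ cls i n) :
    ∃ K, GRep i H H.connectedComponentMk K := by
  obtain ⟨α, g, K, h⟩ := h
  obtain ⟨h1, h3⟩ := hi
  apply strong_of_loc
  intro c
  interval_cases i
  · exact (st_of_rep h c).elim (loc_star _ _ _) (loc_tri _ _)
  · exact (sc_of_rep h c).elim (loc_star _ _ _) (loc_top _ _)
  · exact loc_join _ _ (join_of_rep h c)

lemma ncard_compl {n : ℕ} (P : SimpleGraph (Fin n) → Prop) :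
    {G | P Gᶜ}.ncard = {H | P H}.ncard := by
  rw [← Set.ncard_image_of_injective {H | P H} (compl_injective)]
  congr 1
  ext G
  constructor
  · intro h
    exact ⟨Gᶜ, h, compl_compl G⟩
  · rintro ⟨H, h, rfl⟩
    simpa using h

lemma fstar1_eq (n : ℕ) : fstar1 n = (cls 1 n).ncard := by
  unfold fstar1
  rw [ncard_compl]
  congr 1
  ext H
  constructor
  · intro h
    obtain ⟨K, hK⟩ := strong_of_loc 1 H (fun c => (h c).elim (loc_star _ _ _) (loc_tri _ _))
    exact ⟨_, _, K, hK⟩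
  · rintro ⟨_, _, _, h⟩
    exact st_of_rep h

lemma fstar2_eq (n : ℕ) : fstar2 n = (cls 2 n).ncard := by
  unfold fstar2
  rw [ncard_compl]
  congr 1
  ext H
  constructor
  · intro h
    obtain ⟨K, hK⟩ := strong_of_loc 2 H (fun c => (h c).elim (loc_star _ _ _) (loc_top _ _))
    exact ⟨_, _, K, hK⟩
  · rintro ⟨_, _, _, h⟩
    exact sc_of_rep h

lemma fstar3_eq (n : ℕ) : fstar3 n = (cls 3 n).ncard := by
  unfold fstar3
  rw [ncard_compl]
  congr 1
  ext H
  constructor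
  · intro h
    obtain ⟨K, hK⟩ := strong_of_loc 3 H (fun c => loc_join _ _ (h c))
    exact ⟨_, _, K, hK⟩
  · rintro ⟨_, _, _, h⟩
    exact join_of_rep h

/-- Add a vertex `0` with neighbourhood `N`. -/
def extG {n : ℕ} (H : SimpleGraph (Fin n)) (N : Fin n → Prop) : SimpleGraph (Fin (n + 1)) where
  Adj a b := (∃ a' b', a = Fin.succ a' ∧ b = Fin.succ b' ∧ H.Adj a' b') ∨
    (a = 0 ∧ ∃ b', b = Fin.succ b' ∧ N b') ∨ (b = 0 ∧ ∃ a', a = Fin.succ a' ∧ N a')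
  symm := ⟨by
    rintro a b (⟨a', b', h1, h2, h3⟩ | h | h)
    · exact Or.inl ⟨b', a', h2, h1, h3.symm⟩
    · exact Or.inr (Or.inr h)
    · exact Or.inr (Or.inl h)⟩
  loopless := ⟨by
    rintro a (⟨a', b', rfl, h2, h3⟩ | ⟨rfl, b', h, -⟩ | ⟨rfl, b', h, -⟩)
    · rw [Fin.succ_inj] at h2
      exact h3.ne h2
    · exact Fin.succ_ne_zero _ h.symm
    · exact Fin.succ_ne_zero _ h.symm⟩

lemma extG_ss {n : ℕ} (H : SimpleGraph (Fin n)) (N : Fin n → Prop) (a b : Fin n) :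
    (extG H N).Adj a.succ b.succ ↔ H.Adj a b := by
  simp [extG, Fin.succ_inj, Fin.succ_ne_zero]

lemma extG_0s {n : ℕ} (H : SimpleGraph (Fin n)) (N : Fin n → Prop) (b : Fin n) :
    (extG H N).Adj 0 b.succ ↔ N b := by
  simp [extG, Fin.succ_inj, Fin.succ_ne_zero, (Fin.succ_ne_zero _).symm]

/-- Delete the vertex `0`. -/
def delG {n : ℕ} (H : SimpleGraph (Fin (n + 1))) : SimpleGraph (Fin n) := H.comap Fin.succ

lemma delG_adj {n : ℕ} (H : SimpleGraph (Fin (n + 1))) (a b : Fin n) :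
    (delG H).Adj a b ↔ H.Adj a.succ b.succ := Iff.rfl

lemma eq_extG {n : ℕ} (H : SimpleGraph (Fin (n + 1))) (H' : SimpleGraph (Fin n)) (N : Fin n → Prop)
    (h1 : ∀ a b : Fin n, H.Adj a.succ b.succ ↔ H'.Adj a b) (h2 : ∀ b : Fin n, H.Adj 0 b.succ ↔ N b) :
    H = extG H' N := by
  ext a b
  refine Fin.cases ?_ (fun a => ?_) a <;> refine Fin.cases ?_ (fun b => ?_) b
  · simp
  · rw [h2, extG_0s]
  · rw [SimpleGraph.adj_comm, h2, SimpleGraph.adj_comm, extG_0s]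
  · rw [h1, extG_ss]

lemma del_mem {i n : ℕ} {H : SimpleGraph (Fin (n + 1))} (h : H ∈ cls i (n + 1)) :
    delG H ∈ cls i n := by
  obtain ⟨α, g, K, h1, h2⟩ := h
  refine ⟨α, fun x => g x.succ, fun x => K x.succ, fun a b => ?_, ?_⟩
  · rw [delG_adj, h1]
    simp [Fin.succ_inj]
  · intro a b ha hb hab e
    obtain ⟨q1, q2⟩ := h2 a.succ b.succ ha hb (by simpa [Fin.succ_inj] using hab) e
    refine ⟨fun hi c hc => q1 hi c.succ hc, fun hi => ?_⟩
    obtain ⟨t, ht⟩ := q2 hi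
    induction t using Fin.cases with
    | zero =>
      refine ⟨a, fun c hc => ?_⟩
      have := ht c.succ hc
      simp only [Fin.succ_inj, Fin.succ_ne_zero, or_false] at this
      tauto
    | succ t =>
      refine ⟨t, fun c hc => ?_⟩
      have := ht c.succ hc
      simpa only [Fin.succ_inj] using this

/-- Remove all edges at `u`. -/
def rmG {n : ℕ} (H : SimpleGraph (Fin n)) (u : Fin n) : SimpleGraph (Fin n) where
  Adj a b := H.Adj a b ∧ a ≠ u ∧ b ≠ u
  symm := ⟨fun _ _ h => ⟨h.1.symm, h.2.2, h.2.1⟩⟩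
  loopless := ⟨fun _ h => h.1.ne rfl⟩

/-- Decoding map for the upper bound. -/
def decU {n : ℕ} (H : SimpleGraph (Fin n)) (u : Fin n) (j : Fin 4) : SimpleGraph (Fin (n + 1)) :=
  if j = 0 then extG H (fun _ => False)
  else if j = 1 then extG H (fun b => b = u ∨ H.Adj u b)
  else if j = 2 then extG H (fun b => H.Adj u b)
  else extG (rmG H u) (fun b => b = u ∨ H.Adj u b)

lemma decU_surj {i n : ℕ} (hn : 1 ≤ n) {H : SimpleGraph (Fin (n + 1))} (h : H ∈ cls i (n + 1)) :
    ∃ H' ∈ cls i n, ∃ u j, decU H' u j = H := by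
  have hd := del_mem h
  obtain ⟨α, g, K, h1, h2⟩ := h
  have h10 : ∀ b : Fin n, H.Adj 0 b.succ ↔ g 0 = g b.succ ∧ (K 0 ∨ K b.succ) := fun b => by
    rw [h1]; simp [(Fin.succ_ne_zero _).symm]
  have h1s : ∀ a b : Fin n, H.Adj a.succ b.succ ↔ a ≠ b ∧ g a.succ = g b.succ ∧ (K a.succ ∨ K b.succ) :=
    fun a b => by
    rw [h1]; simp [Fin.succ_inj]
  by_cases hA : ∀ b : Fin n, ¬ H.Adj 0 b.succ
  · refine ⟨delG H, hd, ⟨0, hn⟩, 0, ?_⟩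
    symm
    apply eq_extG
    · intro a b; rfl
    · intro b; simp [hA]
  push Not at hA
  obtain ⟨w, hw⟩ := hA
  by_cases hT : ∃ u : Fin n, ∀ b : Fin n, H.Adj 0 b.succ ↔ (b = u ∨ H.Adj u.succ b.succ)
  · obtain ⟨u, hu⟩ := hT
    refine ⟨delG H, hd, u, 1, ?_⟩
    symm
    apply eq_extG
    · intro a b; rfl
    · intro b; exact hu b
  by_cases hF : ∃ u : Fin n, ∀ b : Fin n, H.Adj 0 b.succ ↔ H.Adj u.succ b.succ
  · obtain ⟨u, hu⟩ := hF
    refine ⟨delG H, hd, u, 2, ?_⟩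
    symm
    apply eq_extG
    · intro a b; rfl
    · intro b; exact hu b
  push Not at hT hF
  -- now `0` is a star centre
  rw [h10] at hw
  have hK0 : K 0 := by
    by_contra hK0
    have hKw : K w.succ := hw.2.resolve_left hK0
    by_cases hs : ∃ s : Fin n, g s.succ = g 0 ∧ ¬ K s.succ
    · obtain ⟨s, hs, hKs⟩ := hs
      obtain ⟨b, hb⟩ := hF s
      rw [h10, h1s] at hb
      have : K b.succ → s ≠ b := by rintro h rfl; exact hKs h
      rw [hs] at hb
      tauto
    · push Not at hs
      obtain ⟨b, hb⟩ := hT w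
      rw [h10, h1s] at hb
      have := hs b
      rw [← hw.1] at hb
      have hw' := hs w
      by_cases e : b = w
      · subst e; tauto
      · have : w ≠ b := Ne.symm e
        have : g 0 = g b.succ → g b.succ = g 0 := Eq.symm
        tauto
  have hKn : ∀ u : Fin n, g u.succ = g 0 → ¬ K u.succ := by
    intro u hu hKu
    obtain ⟨b, hb⟩ := hT u
    rw [h10, h1s, hu] at hb
    by_cases e : b = u
    · subst e
      have := hu.symm
      tauto
    · have : u ≠ b := Ne.symm e
      tauto
  have hw1 := hw.1
  refine ⟨mkG (fun x => g x.succ) (fun x => K x.succ ∨ x = w),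
    ⟨α, _, _, fun a b => Iff.rfl, ?_⟩, w, 3, ?_⟩
  · have key : ∀ a : Fin n, g a.succ = g 0 → (K a.succ ∨ a = w) → a = w :=
      fun a ha h => h.resolve_left (hKn a ha)
    intro a b ha hb hab e
    have hag : g a.succ ≠ g 0 := fun hag =>
      hab ((key a hag ha).trans (key b (e.symm.trans hag) hb).symm)
    have hKa : K a.succ := ha.resolve_right (by rintro rfl; exact hag hw1.symm)
    have hKb : K b.succ := hb.resolve_right (by rintro rfl; exact hag (e.trans hw1.symm))
    obtain ⟨q1, q2⟩ := h2 a.succ b.succ hKa hKb (by simpa [Fin.succ_inj] using hab) e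
    refine ⟨fun hi c hc => Or.inl (q1 hi c.succ hc), fun hi => ?_⟩
    obtain ⟨t, ht⟩ := q2 hi
    induction t using Fin.cases with
    | zero =>
      refine ⟨a, fun c hc => ?_⟩
      have := ht c.succ hc
      simp only [Fin.succ_inj, Fin.succ_ne_zero, or_false] at this
      tauto
    | succ t =>
      refine ⟨t, fun c hc => ?_⟩
      have := ht c.succ hc
      simpa only [Fin.succ_inj] using this
  · symm
    apply eq_extG
    · intro a b
      rw [h1s]
      change _ ↔ (a ≠ b ∧ g a.succ = g b.succ ∧ ((K a.succ ∨ a = w) ∨ (K b.succ ∨ b = w))) ∧ a ≠ w ∧ b ≠ w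
      constructor
      · rintro ⟨x, y, z⟩
        refine ⟨⟨x, y, by tauto⟩, ?_, ?_⟩
        · rintro rfl
          rcases z with z | z
          · exact hKn _ hw1.symm z
          · exact hKn _ (y.symm.trans hw1.symm) z
        · rintro rfl
          rcases z with z | z
          · exact hKn _ (y.trans hw1.symm) z
          · exact hKn _ hw1.symm z
      · tauto
    · intro b
      rw [h10]
      change _ ↔ b = w ∨ (w ≠ b ∧ g w.succ = g b.succ ∧ ((K w.succ ∨ w = w) ∨ _))
      rw [← hw1]
      by_cases e : b = w
      · subst e; tauto
      · have : w ≠ b := Ne.symm e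
        tauto

lemma upper (i n : ℕ) (hn : 1 ≤ n) : (cls i (n + 1)).ncard ≤ 4 * n * (cls i n).ncard := by
  classical
  have hsub : cls i (n + 1) ⊆ (fun p : SimpleGraph (Fin n) × Fin n × Fin 4 => decU p.1 p.2.1 p.2.2) ''
      (cls i n ×ˢ Set.univ) := by
    intro H hH
    obtain ⟨H', hH', u, j, e⟩ := decU_surj hn hH
    exact ⟨(H', u, j), ⟨hH', trivial⟩, e⟩
  calc _ ≤ _ := Set.ncard_le_ncard hsub (Set.toFinite _)
    _ ≤ (cls i n ×ˢ (Set.univ : Set (Fin n × Fin 4))).ncard := Set.ncard_image_le (Set.toFinite _)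
    _ = (cls i n).ncard * (n * 4) := by
      rw [Set.ncard_prod, Set.ncard_univ]; simp
    _ = _ := by ring

lemma Qc_cons {i n : ℕ} {α : Type} {g : Fin n → α} {K : Fin n → Prop} (h : Qc i g K) (c : α)
    (k0 : Prop) (K1 : Fin n → Prop) (hK : ∀ x, g x ≠ c → (K1 x ↔ K x))
    (hc : 3 ≤ i ∨ ((k0 → ∀ x, g x = c → ¬ K1 x) ∧
      (∀ x y, g x = c → g y = c → K1 x → K1 y → x = y))) :
    Qc i (Fin.cons c g : Fin (n + 1) → α) (Fin.cons k0 K1 : Fin (n + 1) → Prop) := by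
  rcases hc with hc | ⟨hc1, hc2⟩
  · intro a b _ _ _ _
    exact ⟨fun h => by omega, fun h => by omega⟩
  intro a b
  refine Fin.cases ?_ (fun a => ?_) a <;> refine Fin.cases ?_ (fun b => ?_) b <;>
    simp only [Fin.cons_zero, Fin.cons_succ]
  · intro _ _ h; exact absurd rfl h
  · intro h0 hb _ e
    exact absurd hb (hc1 h0 b e.symm)
  · intro ha h0 _ e
    exact absurd ha (hc1 h0 a e)
  · intro ha hb hab e
    have hab' : a ≠ b := fun h => hab (by rw [h])
    have hac : g a ≠ c := fun hac => hab' (hc2 a b hac (e ▸ hac) ha hb)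
    obtain ⟨q1, q2⟩ := h a b ((hK a hac).1 ha) ((hK b (e ▸ hac)).1 hb) hab' e
    refine ⟨fun hi x => ?_, fun hi => ?_⟩
    · refine Fin.cases ?_ (fun x => ?_) x <;> simp only [Fin.cons_zero, Fin.cons_succ]
      · intro h; exact absurd h.symm hac
      · intro hx
        exact (hK x (hx ▸ hac)).2 (q1 hi x hx)
    · obtain ⟨t, ht⟩ := q2 hi
      refine ⟨t.succ, fun x => ?_⟩
      refine Fin.cases ?_ (fun x => ?_) x <;> simp only [Fin.cons_zero, Fin.cons_succ]
      · intro h; exact absurd h.symm hac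
      · intro hx
        simpa only [Fin.succ_inj] using ht x hx

/-- Decoding relation for the lower bound. -/
def LowRel {n : ℕ} (H : SimpleGraph (Fin n)) (c : H.ConnectedComponent)
    (H' : SimpleGraph (Fin (n + 1))) : Prop :=
  (∃ b : Fin n, H'.Adj 0 b.succ) ∧ (∀ b : Fin n, H'.Adj 0 b.succ → H.connectedComponentMk b = c) ∧
    (∀ a b : Fin n, H.Adj a b ↔
      H'.Adj a.succ b.succ ∨ (a ≠ b ∧ H'.Adj 0 a.succ ∧ H'.Adj 0 b.succ))

lemma low_aux {i n : ℕ} {H : SimpleGraph (Fin n)} {K : Fin n → Prop}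
    (h : GRep i H H.connectedComponentMk K) (c : H.ConnectedComponent)
    (k0 : Prop) (K1 : Fin n → Prop) (hK : ∀ x, H.connectedComponentMk x ≠ c → (K1 x ↔ K x))
    (hc : 3 ≤ i ∨ ((k0 → ∀ x, H.connectedComponentMk x = c → ¬ K1 x) ∧
      (∀ x y, H.connectedComponentMk x = c → H.connectedComponentMk y = c → K1 x → K1 y → x = y)))
    (hne : ∃ b, H.connectedComponentMk b = c ∧ (k0 ∨ K1 b))
    (hdec : ∀ a b, H.connectedComponentMk a = c → H.connectedComponentMk b = c → a ≠ b →
      ((K a ∨ K b) ↔ (K1 a ∨ K1 b) ∨ ((k0 ∨ K1 a) ∧ (k0 ∨ K1 b)))) :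
    ∃ H' ∈ cls i (n + 1), LowRel H c H' := by
  refine ⟨mkG (Fin.cons c H.connectedComponentMk : Fin (n + 1) → _)
    (Fin.cons k0 K1 : Fin (n + 1) → Prop), ⟨_, _, _, fun a b => Iff.rfl, Qc_cons h.2 c k0 K1 hK hc⟩, ?_⟩
  have e0 : ∀ b : Fin n, (mkG (Fin.cons c H.connectedComponentMk : Fin (n + 1) → _)
    (Fin.cons k0 K1 : Fin (n + 1) → Prop)).Adj 0 b.succ ↔
      c = H.connectedComponentMk b ∧ (k0 ∨ K1 b) := fun b => by
    simp [mkG, (Fin.succ_ne_zero _).symm]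
  have es : ∀ a b : Fin n, (mkG (Fin.cons c H.connectedComponentMk : Fin (n + 1) → _)
    (Fin.cons k0 K1 : Fin (n + 1) → Prop)).Adj a.succ b.succ ↔
      a ≠ b ∧ H.connectedComponentMk a = H.connectedComponentMk b ∧ (K1 a ∨ K1 b) := fun a b => by
    simp only [mkG, Fin.cons_succ, ne_eq, Fin.succ_inj]
  refine ⟨?_, ?_, ?_⟩
  · obtain ⟨b, hb, hb'⟩ := hne
    exact ⟨b, (e0 b).2 ⟨hb.symm, hb'⟩⟩
  · intro b hb
    exact ((e0 b).1 hb).1.symm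
  · intro a b
    rw [es, e0, e0, h.1]
    by_cases hab : a = b
    · simp [hab]
    by_cases ha : H.connectedComponentMk a = c
    · by_cases hb : H.connectedComponentMk b = c
      · have := hdec a b ha hb hab
        simpa only [ha, hb, ne_eq, hab, not_false_eq_true, true_and] using this
      · have h1 : ¬ (H.connectedComponentMk a = H.connectedComponentMk b) := fun h => hb (h ▸ ha)
        have h2 : ¬ (c = H.connectedComponentMk b) := fun h => hb h.symm
        simp only [h1, h2, false_and, and_false, or_false]
    · have h2 : ¬ (c = H.connectedComponentMk a) := fun h => ha h.symm
      by_cases e : H.connectedComponentMk a = H.connectedComponentMk b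
      · have k1 := hK a ha
        have k2 := hK b (e ▸ ha)
        simp only [k1, k2, h2, false_and, and_false, or_false]
      · simp only [e, h2, false_and, and_false, or_false]

lemma low_ext {i n : ℕ} (hi : 1 ≤ i ∧ i ≤ 3) {H : SimpleGraph (Fin n)} (hH : H ∈ cls i n)
    (c : H.ConnectedComponent) : ∃ H' ∈ cls i (n + 1), LowRel H c H' := by
  obtain ⟨K, h⟩ := mem_cls_strong hi hH
  by_cases h0 : ∀ x, H.connectedComponentMk x = c → ¬ K x
  · obtain ⟨x0, hx0⟩ := c.nonempty_supp
    refine low_aux h c True K (fun _ _ => Iff.rfl) (Or.inr ⟨fun _ => h0, ?_⟩) ⟨x0, hx0, Or.inl trivial⟩ ?_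
    · intro x y hx _ hKx
      exact absurd hKx (h0 x hx)
    · intro a b ha hb hab
      exact absurd (comp_single h c ha hb h0) hab
  push Not at h0
  obtain ⟨k, hk, hKk⟩ := h0
  by_cases hu : 3 ≤ i ∨ ∀ x y, H.connectedComponentMk x = c → H.connectedComponentMk y = c →
      K x → K y → x = y
  · refine low_aux h c False K (fun _ _ => Iff.rfl) ?_ ⟨k, hk, Or.inr hKk⟩ ?_
    · exact hu.imp id (fun h => ⟨False.elim, h⟩)
    · intro a b _ _ _
      tauto
  · push Not at hu
    obtain ⟨hi3, x, y, hx, hy, hKx, hKy, hxy⟩ := hu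
    have hall := (h.2 x y hKx hKy hxy (hx.trans hy.symm)).1 (by omega)
    refine low_aux h c True (fun z => K z ∧ H.connectedComponentMk z ≠ c) ?_ (Or.inr ⟨?_, ?_⟩)
      ⟨k, hk, Or.inl trivial⟩ ?_
    · intro z hz; tauto
    · intro _ z hz; tauto
    · intro z _ hz _ hz'; tauto
    · intro a b ha _ _
      have := hall a (ha.trans hx.symm)
      tauto

lemma LowRel_inj {n : ℕ} {H1 H2 : SimpleGraph (Fin n)} {c1 : H1.ConnectedComponent}
    {c2 : H2.ConnectedComponent} {H' : SimpleGraph (Fin (n + 1))} (h1 : LowRel H1 c1 H')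
    (h2 : LowRel H2 c2 H') : H1 = H2 ∧ HEq c1 c2 := by
  have e : H1 = H2 := by
    ext a b
    rw [h1.2.2, h2.2.2]
  subst e
  refine ⟨rfl, heq_of_eq ?_⟩
  obtain ⟨b, hb⟩ := h1.1
  rw [← h1.2.1 b hb, ← h2.2.1 b hb]

lemma low_count (i n m : ℕ) (hi : 1 ≤ i ∧ i ≤ 3) :
    {H ∈ cls i n | m ≤ Nat.card H.ConnectedComponent}.ncard * m ≤ (cls i (n + 1)).ncard := by
  classical
  set S := {H ∈ cls i n | m ≤ Nat.card H.ConnectedComponent} with hS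
  have hemb : ∀ H : S, ∃ f : Fin m → H.1.ConnectedComponent, Function.Injective f := by
    intro H
    have : Fintype H.1.ConnectedComponent := Fintype.ofFinite _
    have h1 := H.2.2
    rw [Nat.card_eq_fintype_card] at h1
    have : Nonempty (Fin m ↪ H.1.ConnectedComponent) := by
      apply Function.Embedding.nonempty_of_card_le
      simpa using h1
    obtain ⟨f⟩ := this
    exact ⟨f, f.injective⟩
  choose f hf using hemb
  have hex : ∀ p : S × Fin m, ∃ H' : cls i (n + 1), LowRel p.1.1 (f p.1 p.2) H'.1 := by
    intro p
    obtain ⟨H', h1, h2⟩ := low_ext hi p.1.2.1 (f p.1 p.2)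
    exact ⟨⟨H', h1⟩, h2⟩
  choose F hF using hex
  have hinj : Function.Injective F := by
    rintro ⟨H1, j1⟩ ⟨H2, j2⟩ e
    have r1 := hF (H1, j1)
    have r2 := hF (H2, j2)
    rw [← e] at r2
    obtain ⟨e1, e2⟩ := LowRel_inj r1 r2
    have e1' : H1 = H2 := Subtype.ext e1
    subst e1'
    have e3 : j1 = j2 := hf H1 (eq_of_heq e2)
    rw [e3]
  have := Nat.card_le_card_of_injective F hinj
  rw [Nat.card_prod, Nat.card_coe_set_eq, Nat.card_coe_set_eq, Nat.card_fin] at this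
  exact this

lemma few_count (i n p : ℕ) (hi : 1 ≤ i ∧ i ≤ 3) :
    {H ∈ cls i n | Nat.card H.ConnectedComponent ≤ p}.ncard ≤ (p * 2) ^ n := by
  classical
  have hsub : {H ∈ cls i n | Nat.card H.ConnectedComponent ≤ p} ⊆
      (fun q : Fin n → Fin p × Bool => mkG (fun x => (q x).1) (fun x => (q x).2 = true)) '' Set.univ := by
    rintro H ⟨hH, hp⟩
    obtain ⟨K, h1, -⟩ := mem_cls_strong hi hH
    have : Fintype H.ConnectedComponent := Fintype.ofFinite _
    rw [Nat.card_eq_fintype_card] at hp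
    have : Nonempty (H.ConnectedComponent ↪ Fin p) := by
      apply Function.Embedding.nonempty_of_card_le
      simpa using hp
    obtain ⟨f⟩ := this
    refine ⟨fun x => (f (H.connectedComponentMk x), decide (K x)), trivial, ?_⟩
    ext a b
    rw [h1]
    simp only [mkG, decide_eq_true_eq, f.injective.eq_iff]
  refine (Set.ncard_le_ncard hsub (Set.toFinite _)).trans ((Set.ncard_image_le (Set.toFinite _)).trans ?_)
  rw [Set.ncard_univ]
  simp

lemma many_count (i n k : ℕ) (hk : k ≤ n) : k ^ (n - k) ≤ (cls i n).ncard := by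
  classical
  let G : (Fin (n - k) → Fin k) → Fin n → Fin k := fun h x =>
    if hx : x.1 < k then ⟨x.1, hx⟩ else h ⟨x.1 - k, by omega⟩
  have hmem : ∀ h, mkG (G h) (fun x => x.1 < k) ∈ cls i n := by
    intro h
    refine ⟨_, _, _, fun a b => Iff.rfl, ?_⟩
    intro a b ha hb hab e
    exfalso
    apply hab
    simp only [G, dif_pos ha, dif_pos hb, Fin.mk.injEq] at e
    exact Fin.ext e
  let F : (Fin (n - k) → Fin k) → cls i n := fun h => ⟨_, hmem h⟩
  have hinj : Function.Injective F := by
    intro h h' e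
    have e : mkG (G h) (fun x => x.1 < k) = mkG (G h') (fun x => x.1 < k) := congrArg Subtype.val e
    funext j
    have hj := j.2
    let x : Fin n := ⟨j.1 + k, by omega⟩
    let y : Fin n := ⟨(h j).1, by omega⟩
    have gx : ∀ h, G h x = h j := fun h => by simp [G, x]
    have gy : ∀ h', G h' y = h j := fun h' => by simp [G, y]
    have hxy : (mkG (G h) (fun x => x.1 < k)).Adj x y := by
      refine ⟨?_, ?_, Or.inr (h j).2⟩
      · intro hc
        have := congrArg Fin.val hc
        have h2 := (h j).2
        simp only [x, y] at this
        omega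
      · rw [gx, gy]
    rw [e] at hxy
    have := hxy.2.1
    rw [gx, gy] at this
    exact this.symm
  have := Nat.card_le_card_of_injective F hinj
  rw [Nat.card_coe_set_eq, Nat.card_fun, Nat.card_fin, Nat.card_fin] at this
  exact this

lemma arith (n : ℕ) (hn : 2 ≤ n) (p k : ℕ) (hp : (p : ℝ) ≤ n / (8 * Real.logb 2 n))
    (hk1 : (n : ℝ) / Real.logb 2 n ≤ k) (hk2 : (k : ℝ) ≤ n / Real.logb 2 n + 1) (hkn : k ≤ n) :
    2 * ((p : ℝ) * 2) ^ n ≤ (k : ℝ) ^ (n - k) := by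
  have hn' : (2 : ℝ) ≤ n := by exact_mod_cast hn
  set L := Real.logb 2 n with hL
  have hL1 : 1 ≤ L := by
    rw [hL, Real.le_logb_iff_rpow_le (by norm_num) (by linarith)]
    simpa using hn'
  have hL0 : 0 < L := by linarith
  have h2L : (2 : ℝ) ^ L = n := Real.rpow_logb (by norm_num) (by norm_num) (by linarith)
  have hkpos : (0 : ℝ) < k := lt_of_lt_of_le (by positivity) hk1
  have hkk : 2 * (k : ℝ) ^ k ≤ 4 ^ n := by
    have a1 : (k : ℝ) ^ k ≤ (n : ℝ) ^ k := by
      gcongr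
    have a2 : (n : ℝ) ^ k ≤ 2 ^ n * n := by
      calc (n : ℝ) ^ k = (2 : ℝ) ^ (L * k) := by
            rw [Real.rpow_mul (by norm_num), h2L, Real.rpow_natCast]
        _ ≤ (2 : ℝ) ^ ((n : ℝ) + L) := by
            apply Real.rpow_le_rpow_of_exponent_le (by norm_num)
            calc L * k ≤ L * (n / L + 1) := by gcongr
              _ = n + L := by field_simp
        _ = 2 ^ n * n := by
            rw [Real.rpow_add (by norm_num), h2L, Real.rpow_natCast]
    have a3 : 2 * n ≤ 2 ^ n := by
      clear * - hn
      induction n, hn using Nat.le_induction with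
      | base => norm_num
      | succ m hm ih => rw [pow_succ]; omega
    have a3' : 2 * (n : ℝ) ≤ 2 ^ n := by exact_mod_cast a3
    have a4 : (4 : ℝ) ^ n = 2 ^ n * 2 ^ n := by rw [← mul_pow]; norm_num
    rw [a4]
    have : (0 : ℝ) < 2 ^ n := by positivity
    nlinarith
  have hp4 : (p : ℝ) * 2 * 4 ≤ k := by
    calc (p : ℝ) * 2 * 4 ≤ n / (8 * L) * 2 * 4 := by gcongr
      _ = n / L := by field_simp; norm_num
      _ ≤ k := hk1
  have hmain : 2 * ((p : ℝ) * 2) ^ n * (k : ℝ) ^ k ≤ (k : ℝ) ^ (n - k) * (k : ℝ) ^ k := by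
    rw [← pow_add, Nat.sub_add_cancel hkn]
    calc 2 * ((p : ℝ) * 2) ^ n * (k : ℝ) ^ k = ((p : ℝ) * 2) ^ n * (2 * (k : ℝ) ^ k) := by ring
      _ ≤ ((p : ℝ) * 2) ^ n * 4 ^ n := by gcongr
      _ = ((p : ℝ) * 2 * 4) ^ n := by rw [mul_pow _ 4]
      _ ≤ _ := by gcongr
  exact le_of_mul_le_mul_right hmain (by positivity)

lemma lower (i n : ℕ) (hi : 1 ≤ i ∧ i ≤ 3) (hn : 2 ≤ n) :
    (n : ℝ) * ((cls i n).ncard : ℝ) / (16 * Real.logb 2 n) ≤ ((cls i (n + 1)).ncard : ℝ) := by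
  have hn' : (2 : ℝ) ≤ n := by exact_mod_cast hn
  have hL1 : 1 ≤ Real.logb 2 n := by
    rw [Real.le_logb_iff_rpow_le (by norm_num) (by linarith)]
    simpa using hn'
  have hL0 : 0 < Real.logb 2 n := by linarith
  set x : ℝ := n / (8 * Real.logb 2 n) with hx
  have hx0 : 0 ≤ x := by positivity
  have hkn : ⌈(n : ℝ) / Real.logb 2 n⌉₊ ≤ n := by
    rw [Nat.ceil_le]
    exact div_le_self (by linarith) hL1
  have har := arith n hn ⌊x⌋₊ ⌈(n : ℝ) / Real.logb 2 n⌉₊ (Nat.floor_le hx0) (Nat.le_ceil _)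
    (Nat.ceil_lt_add_one (by positivity)).le hkn
  have hfew := few_count i n ⌊x⌋₊ hi
  have hmany := many_count i n _ hkn
  have hlow := low_count i n (⌊x⌋₊ + 1) hi
  have hsplit : (cls i n).ncard ≤ {H ∈ cls i n | Nat.card H.ConnectedComponent ≤ ⌊x⌋₊}.ncard +
      {H ∈ cls i n | ⌊x⌋₊ + 1 ≤ Nat.card H.ConnectedComponent}.ncard := by
    refine le_trans (Set.ncard_le_ncard ?_ (Set.toFinite _)) (Set.ncard_union_le _ _)
    intro H hH
    rcases Nat.lt_or_ge ⌊x⌋₊ (Nat.card H.ConnectedComponent) with h | h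
    · exact Or.inr ⟨hH, h⟩
    · exact Or.inl ⟨hH, h⟩
  set A := {H ∈ cls i n | Nat.card H.ConnectedComponent ≤ ⌊x⌋₊}.ncard
  set B := {H ∈ cls i n | ⌊x⌋₊ + 1 ≤ Nat.card H.ConnectedComponent}.ncard
  set f := (cls i n).ncard
  have hfew' : (A : ℝ) ≤ ((⌊x⌋₊ : ℝ) * 2) ^ n := by exact_mod_cast hfew
  have hmany' : ((⌈(n : ℝ) / Real.logb 2 n⌉₊ : ℕ) : ℝ) ^ (n - ⌈(n : ℝ) / Real.logb 2 n⌉₊) ≤ f := by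
    exact_mod_cast hmany
  have hlow' : (B : ℝ) * ((⌊x⌋₊ : ℝ) + 1) ≤ ((cls i (n + 1)).ncard : ℝ) := by exact_mod_cast hlow
  have hsplit' : (f : ℝ) ≤ A + B := by exact_mod_cast hsplit
  have hB : (f : ℝ) / 2 ≤ B := by linarith
  have hfl := Nat.lt_floor_add_one x
  calc (n : ℝ) * f / (16 * Real.logb 2 n) = f / 2 * x := by rw [hx]; field_simp; ring
    _ ≤ B * ((⌊x⌋₊ : ℝ) + 1) := by gcongr
    _ ≤ _ := hlow'

/-- For sufficiently large `n` and each `i ∈ {1,2,3}`: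
`n·f*ᵢ(n)/(16·log₂ n) ≤ f*ᵢ(n+1) ≤ 4n·f*ᵢ(n)`. -/
theorem stmt_18 :
    ∃ n0 : ℕ, ∀ n : ℕ, n0 ≤ n →
      ((n : ℝ) * (fstar1 n : ℝ) / (16 * Real.logb 2 n) ≤ (fstar1 (n + 1) : ℝ) ∧
        (fstar1 (n + 1) : ℝ) ≤ 4 * (n : ℝ) * (fstar1 n : ℝ)) ∧
      ((n : ℝ) * (fstar2 n : ℝ) / (16 * Real.logb 2 n) ≤ (fstar2 (n + 1) : ℝ) ∧
        (fstar2 (n + 1) : ℝ) ≤ 4 * (n : ℝ) * (fstar2 n : ℝ)) ∧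
      ((n : ℝ) * (fstar3 n : ℝ) / (16 * Real.logb 2 n) ≤ (fstar3 (n + 1) : ℝ) ∧
        (fstar3 (n + 1) : ℝ) ≤ 4 * (n : ℝ) * (fstar3 n : ℝ)) := by
  refine ⟨2, fun n hn => ?_⟩
  have hup : ∀ i, ((cls i (n + 1)).ncard : ℝ) ≤ 4 * (n : ℝ) * ((cls i n).ncard : ℝ) := fun i => by
    exact_mod_cast upper i n (by omega)
  simp only [fstar1_eq, fstar2_eq, fstar3_eq]
  exact ⟨⟨lower 1 n (by norm_num) hn, hup 1⟩, ⟨lower 2 n (by norm_num) hn, hup 2⟩,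
    ⟨lower 3 n (by norm_num) hn, hup 3⟩⟩
end

section
/- Let p ≥ 1 be a fixed integer and let F_1,…,F_p be classes of finite graphs, each closed under isomorphism, such that: (1) every graph in F_1 is P_4-free or has girth at least 5; and (2) there is l_0 such that for every i > 1 and every l ≥ l_0, every graph in F_i on l vertices has minimum degree at least 31l/32 + 1. Then for every μ > 0 there are a constant C and n_0 such that for all n ≥ n_0 the following holds: the number of pairs (G, (X_1,…,X_p)), where G is a graph on vertex set {1,…,n} and X_1,…,X_p is a partition of {1,…,n} with G[X_i] ∈ F_i and ||X_i| − n/p| < n^{1−μ} for every i, is at least the number of graphs on {1,…,n} admitting at least one such partition and at most C times that number. -/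
open SimpleGraph Filter

/-- `G` contains no induced copy of `H`. -/
def IndFree {W V : Type*} (H : SimpleGraph W) (G : SimpleGraph V) : Prop :=
  ¬ Nonempty (H ↪g G)

/-- A class of finite graphs: a predicate on graphs over every finite vertex type. -/
abbrev GraphClass : Type 1 := ∀ (V : Type) [Finite V], SimpleGraph V → Prop

/-- A class of finite graphs is hereditary if it is closed under isomorphism and
under taking induced subgraphs (equivalently, closed under induced-subgraph
embeddings). -/
def GraphClass.Hereditary (F : GraphClass) : Prop :=
  ∀ (V W : Type) [Finite V] [Finite W] (G : SimpleGraph V) (L : SimpleGraph W),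
    Nonempty (L ↪g G) → F V G → F W L

/-- The class contains all complete graphs. -/
def GraphClass.ContainsAllCliques (F : GraphClass) : Prop :=
  ∀ (V : Type) [Finite V], F V ⊤

/-- The class contains all edgeless graphs. -/
def GraphClass.ContainsAllStables (F : GraphClass) : Prop :=
  ∀ (V : Type) [Finite V], F V ⊥

/-- `(F 0, …, F (k-1))` is an `H`-freeness witnessing `k`-sequence: a sequence of
hereditary classes such that for every partition of `V(H)` into `k` parts some part
induces a graph outside the corresponding class. -/
def IsWitnessingSeq {VH : Type} [Finite VH] (H : SimpleGraph VH) (k : ℕ)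
    (F : Fin k → GraphClass) : Prop :=
  (∀ i, (F i).Hereditary) ∧
  ∀ X : VH → Fin k, ∃ i, ¬ F i ↥{v | X v = i} (H.induce {v | X v = i})

/-- `F` is canonical for `H`: there is a set `J` of induced subgraphs of `H` such that
`F` is exactly the class of graphs containing no induced copy of a member of `J`. -/
def IsCanonicalFor {VH : Type} [Finite VH] (H : SimpleGraph VH) (F : GraphClass) : Prop :=
  ∃ J : GraphClass,
    (∀ (W : Type) [Finite W] (L : SimpleGraph W), J W L → Nonempty (L ↪g H)) ∧
    ∀ (V : Type) [Finite V] (G : SimpleGraph V),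
      F V G ↔ ∀ (W : Type) [Finite W] (L : SimpleGraph W), J W L → IndFree L G

/-- A really canonical `H`-freeness witnessing `k`-sequence: a witnessing sequence in
which each class is canonical and contains all cliques or all stable sets. -/
def IsReallyCanonicalSeq {VH : Type} [Finite VH] (H : SimpleGraph VH) (k : ℕ)
    (F : Fin k → GraphClass) : Prop :=
  IsWitnessingSeq H k F ∧
  ∀ i, IsCanonicalFor H (F i) ∧
    ((F i).ContainsAllCliques ∨ (F i).ContainsAllStables)

/-- `V(H)` can be partitioned into `c` cliques and `s` stable sets. -/
def HasCSPartition {VH : Type} (H : SimpleGraph VH) (c s : ℕ) : Prop :=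
  ∃ f : VH → (Fin c ⊕ Fin s),
    (∀ i : Fin c, H.IsClique {v | f v = Sum.inl i}) ∧
    (∀ j : Fin s, ∀ a, f a = Sum.inr j → ∀ b, f b = Sum.inr j → ¬ H.Adj a b)

/-- `r` is the witnessing partition number of `H`: the greatest `m` such that for some
`c + s = m` there is no partition of `V(H)` into `c` cliques and `s` stable sets. -/
def IsWpn {VH : Type} (H : SimpleGraph VH) (r : ℕ) : Prop :=
  IsGreatest {m | ∃ c s : ℕ, c + s = m ∧ ¬ HasCSPartition H c s} r

/-- `G` has girth at least 5: it contains no cycle of length 3 or 4. -/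
def GirthAtLeastFive {V : Type*} (G : SimpleGraph V) : Prop :=
  ∀ (v : V) (w : G.Walk v v), w.IsCycle → w.length ≠ 3 ∧ w.length ≠ 4

/-- A good (graph, partition) pair: `X` partitions `{1,…,n}`, each induced subgraph
`G[X i]` belongs to `F i`, and each part has size within `n^{1-μ}` of `n/p`. -/
def GoodPair {p : ℕ} (F : Fin p → GraphClass) (μ : ℝ) {n : ℕ}
    (G : SimpleGraph (Fin n)) (X : Fin p → Set (Fin n)) : Prop :=
  (∀ i j : Fin p, i ≠ j → Disjoint (X i) (X j)) ∧
  (⋃ i, X i) = Set.univ ∧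
  (∀ i, F i ↥(X i) (G.induce (X i))) ∧
  (∀ i, |((X i).ncard : ℝ) - (n : ℝ) / p| < (n : ℝ) ^ ((1 : ℝ) - μ))

section Aux
open Finset
open scoped Classical

/-- The graph `G` with the pair `u v` flipped. -/
noncomputable def toggleEdge {V : Type*} (G : SimpleGraph V) (u v : V) : SimpleGraph V :=
  symmDiff G (SimpleGraph.edge u v)

theorem toggleEdge_adj_self {V : Type*} (G : SimpleGraph V) {u v : V} (h : u ≠ v) :
    (toggleEdge G u v).Adj u v ↔ ¬ G.Adj u v := by
  simp [toggleEdge, symmDiff_def, SimpleGraph.sup_adj, SimpleGraph.sdiff_adj,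
    SimpleGraph.edge_adj, h]

theorem toggleEdge_adj_of_ne {V : Type*} (G : SimpleGraph V) {u v x y : V}
    (h1 : ¬ (x = u ∧ y = v)) (h2 : ¬ (x = v ∧ y = u)) :
    (toggleEdge G u v).Adj x y ↔ G.Adj x y := by
  simp only [toggleEdge, symmDiff_def, SimpleGraph.sup_adj, SimpleGraph.sdiff_adj,
    SimpleGraph.edge_adj]
  tauto

theorem toggleEdge_toggleEdge {V : Type*} (G : SimpleGraph V) (u v : V) :
    toggleEdge (toggleEdge G u v) u v = G := by
  simp [toggleEdge]

/-- Weight attached to a set of pairs: each non-edge contributes a factor `1/2`. -/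
noncomputable def pairWeight {V : Type*} (E : Finset (V × V)) (G : SimpleGraph V) : ℝ :=
  ∏ e ∈ E, (if G.Adj e.1 e.2 then (1 : ℝ) else 1 / 2)

theorem sum_pairWeight {V : Type*} (Γ : Finset (SimpleGraph V)) (A B : Finset V)
    (hAB : Disjoint A B)
    (hΓ : ∀ G ∈ Γ, ∀ u ∈ A, ∀ v ∈ B, toggleEdge G u v ∈ Γ)
    (E : Finset (V × V)) (hE : E ⊆ A ×ˢ B) :
    ∑ G ∈ Γ, pairWeight E G = (3 / 4 : ℝ) ^ E.card * Γ.card := by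
  induction E using Finset.induction_on with
  | empty => simp [pairWeight]
  | insert e E he ih =>
    have ih' := ih (fun x hx => hE (mem_insert_of_mem hx))
    obtain ⟨u, v⟩ := e
    have huv := hE (mem_insert_self _ _)
    rw [mem_product] at huv
    have hne : u ≠ v := fun h => by
      have h1 := huv.1
      have h2 := huv.2
      simp only at h1 h2
      rw [h] at h1
      exact Finset.disjoint_left.1 hAB h1 h2
    have hinv : ∀ G, pairWeight E (toggleEdge G u v) = pairWeight E G := by
      intro G
      refine prod_congr rfl fun x hx => ?_
      have hxm := mem_product.1 (hE (mem_insert_of_mem hx))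
      rw [toggleEdge_adj_of_ne]
      · rintro ⟨h1, h2⟩
        exact he (by rw [← h1, ← h2]; exact hx)
      · rintro ⟨h1, h2⟩
        refine Finset.disjoint_left.1 hAB hxm.1 ?_
        rw [h1]; exact huv.2
    have hstep : ∀ G, pairWeight (insert (u, v) E) G =
        (if G.Adj u v then (1 : ℝ) else 1 / 2) * pairWeight E G := by
      intro G
      simp only [pairWeight]
      rw [prod_insert he]
    have hswap : ∑ G ∈ Γ, pairWeight (insert (u, v) E) G =
        ∑ G ∈ Γ, pairWeight (insert (u, v) E) (toggleEdge G u v) := by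
      refine sum_bij' (fun G _ => toggleEdge G u v) (fun G _ => toggleEdge G u v) ?_ ?_ ?_ ?_ ?_
      · intro G hG; exact hΓ G hG u huv.1 v huv.2
      · intro G hG; exact hΓ G hG u huv.1 v huv.2
      · intro G hG; exact toggleEdge_toggleEdge G u v
      · intro G hG; exact toggleEdge_toggleEdge G u v
      · intro G hG; rw [toggleEdge_toggleEdge]
    have hdouble : 2 * ∑ G ∈ Γ, pairWeight (insert (u, v) E) G =
        (3 / 2) * ∑ G ∈ Γ, pairWeight E G := by
      rw [two_mul]
      nth_rewrite 2 [hswap]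
      rw [← sum_add_distrib, mul_sum]
      refine sum_congr rfl fun G _ => ?_
      rw [hstep, hstep, hinv, toggleEdge_adj_self G hne]
      by_cases h : G.Adj u v <;> simp [h] <;> ring
    rw [card_insert_of_notMem he, pow_succ]
    rw [ih'] at hdouble
    linarith

/-- The pair `(A, B)` has few non-edges in `G`. -/
def FewNonedges {V : Type*} (G : SimpleGraph V) (A B : Finset V) : Prop :=
  4 * ((A ×ˢ B).filter (fun e => ¬ G.Adj e.1 e.2)).card ≤ A.card * B.card

theorem card_fewNonedges {V : Type*} (Γ : Finset (SimpleGraph V)) (A B : Finset V)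
    (hAB : Disjoint A B)
    (hΓ : ∀ G ∈ Γ, ∀ u ∈ A, ∀ v ∈ B, toggleEdge G u v ∈ Γ) :
    ((Γ.filter (fun G => FewNonedges G A B)).card : ℝ) ≤
      (9 / 10 : ℝ) ^ (A.card * B.card) * Γ.card := by
  have hs := sum_pairWeight Γ A B hAB hΓ (A ×ˢ B) (Finset.Subset.refl _)
  rw [card_product] at hs
  set m := A.card * B.card with hm
  have hw : ∀ G : SimpleGraph V, pairWeight (A ×ˢ B) G =
      (1 / 2 : ℝ) ^ ((A ×ˢ B).filter (fun e => ¬ G.Adj e.1 e.2)).card := by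
    intro G
    simp only [pairWeight]
    rw [prod_ite]
    simp
  have hlow : ((Γ.filter (fun G => FewNonedges G A B)).card : ℝ) * (5 / 6 : ℝ) ^ m ≤
      ∑ G ∈ Γ, pairWeight (A ×ˢ B) G := by
    rw [← nsmul_eq_mul]
    calc _ ≤ ∑ G ∈ Γ.filter (fun G => FewNonedges G A B), pairWeight (A ×ˢ B) G := by
          refine card_nsmul_le_sum _ _ _ fun G hG => ?_
          have hb : FewNonedges G A B := (mem_filter.1 hG).2
          rw [hw]
          unfold FewNonedges at hb
          set k := ((A ×ˢ B).filter (fun e => ¬ G.Adj e.1 e.2)).card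
          calc (5 / 6 : ℝ) ^ m ≤ (5 / 6 : ℝ) ^ (4 * k) :=
                pow_le_pow_of_le_one (by norm_num) (by norm_num) hb
            _ = ((5 / 6 : ℝ) ^ 4) ^ k := by rw [pow_mul]
            _ ≤ (1 / 2 : ℝ) ^ k := by
                apply pow_le_pow_left₀ <;> norm_num
      _ ≤ _ := by
          refine sum_le_sum_of_subset_of_nonneg (filter_subset _ _) fun G _ _ => ?_
          rw [hw]; positivity
  rw [hs] at hlow
  have h5 : (0 : ℝ) < (5 / 6 : ℝ) ^ m := by positivity
  have h9 : (3 / 4 : ℝ) ^ m = (9 / 10 : ℝ) ^ m * (5 / 6 : ℝ) ^ m := by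
    rw [← mul_pow]; norm_num
  rw [h9] at hlow
  refine le_of_mul_le_mul_right (hlow.trans (le_of_eq ?_)) h5
  ring

theorem toggleEdge_induce {V : Type*} (G : SimpleGraph V) (u v : V) (S : Set V)
    (h : ¬ (u ∈ S ∧ v ∈ S)) : (toggleEdge G u v).induce S = G.induce S := by
  ext ⟨x, hx⟩ ⟨y, hy⟩
  simp only [SimpleGraph.comap_adj, Function.Embedding.subtype_apply]
  apply toggleEdge_adj_of_ne
  · rintro ⟨rfl, rfl⟩; exact h ⟨hx, hy⟩
  · rintro ⟨rfl, rfl⟩; exact h ⟨hy, hx⟩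

theorem GoodPair.toggle {p : ℕ} {F : Fin p → GraphClass} {μ : ℝ} {n : ℕ}
    {G : SimpleGraph (Fin n)} {X : Fin p → Set (Fin n)} (h : GoodPair F μ G X)
    {a : Fin p} {u v : Fin n} (hu : u ∈ X a) (hv : v ∉ X a) :
    GoodPair F μ (toggleEdge G u v) X := by
  obtain ⟨h1, h2, h3, h4⟩ := h
  refine ⟨h1, h2, fun i => ?_, h4⟩
  rw [toggleEdge_induce]
  · exact h3 i
  · rintro ⟨hu', hv'⟩
    by_cases hia : i = a
    · rw [hia] at hv'; exact hv hv'
    · exact Set.disjoint_left.1 (h1 i a hia) hu' hu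

/-- The random-like condition on the crossing pairs. -/
def Typical {p n : ℕ} (G : SimpleGraph (Fin n)) (X : Fin p → Set (Fin n)) : Prop :=
  ∀ (a : Fin p) (A B : Finset (Fin n)), (A : Set (Fin n)) ⊆ X a → Disjoint (B : Set (Fin n)) (X a) →
    (20 * n ≤ A.card * B.card ∨ ((A : Set (Fin n)) = X a ∧ B.card = 1)) → ¬ FewNonedges G A B

theorem card_not_typical {p n : ℕ} (F : Fin p → GraphClass) (μ : ℝ)
    (X : Fin p → Set (Fin n)) (k : ℕ) (hk : ∀ i, k ≤ (X i).ncard)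
    (hn : (p : ℝ) * (1 / 2) ^ n + p * n * (9 / 10) ^ k ≤ 1 / 2)
    (Γ : Finset (SimpleGraph (Fin n))) (hΓ : ∀ G, G ∈ Γ ↔ GoodPair F μ G X) :
    ((Γ.filter (fun G => ¬ Typical G X)).card : ℝ) ≤ (1 / 2) * Γ.card := by
  have hone : ∀ (a : Fin p) (A B : Finset (Fin n)), (A : Set (Fin n)) ⊆ X a →
      Disjoint (B : Set (Fin n)) (X a) → ((Γ.filter (fun G => FewNonedges G A B)).card : ℝ) ≤
      (9 / 10 : ℝ) ^ (A.card * B.card) * Γ.card := by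
    intro a A B hA hB
    refine card_fewNonedges Γ A B ?_ ?_
    · rw [Finset.disjoint_left]
      intro x hx hx'
      exact Set.disjoint_left.1 hB hx' (hA hx)
    · intro G hG u hu v hv
      rw [hΓ] at hG ⊢
      exact hG.toggle (hA hu) (Set.disjoint_left.1 hB hv)
  -- first family
  let I1 : Finset (Fin p × Finset (Fin n) × Finset (Fin n)) :=
    univ.filter (fun t => (t.2.1 : Set (Fin n)) ⊆ X t.1 ∧
      Disjoint (t.2.2 : Set (Fin n)) (X t.1) ∧ 20 * n ≤ t.2.1.card * t.2.2.card)
  let I2 : Finset (Fin p × Fin n) := univ.filter (fun t => t.2 ∉ X t.1)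
  have hsub : Γ.filter (fun G => ¬ Typical G X) ⊆
      (I1.biUnion fun t => Γ.filter (fun G => FewNonedges G t.2.1 t.2.2)) ∪
      (I2.biUnion fun t => Γ.filter (fun G => FewNonedges G (X t.1).toFinset {t.2})) := by
    intro G hG
    rw [mem_filter] at hG
    obtain ⟨hG, hT⟩ := hG
    unfold Typical at hT
    push Not at hT
    obtain ⟨a, A, B, hA, hB, hc, hF⟩ := hT
    rw [mem_union, mem_biUnion, mem_biUnion]
    rcases hc with hc | ⟨hc, hc'⟩
    · left
      exact ⟨(a, A, B), by simp [I1, hA, hB, hc], by simp [hG, hF]⟩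
    · right
      obtain ⟨v, rfl⟩ := card_eq_one.1 hc'
      have hAe : (X a).toFinset = A := by
        ext x; simp [← hc]
      refine ⟨(a, v), ?_, ?_⟩
      · simpa [I2] using hB
      · rw [mem_filter]
        refine ⟨hG, ?_⟩
        simp only
        rw [hAe]
        exact hF
  have hc1 : ((I1.biUnion fun t => Γ.filter (fun G => FewNonedges G t.2.1 t.2.2)).card : ℝ) ≤
      p * (1 / 2) ^ n * Γ.card := by
    calc _ ≤ ((∑ t ∈ I1, (Γ.filter (fun G => FewNonedges G t.2.1 t.2.2)).card : ℕ) : ℝ) := by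
          exact_mod_cast card_biUnion_le
      _ ≤ ∑ t ∈ I1, ((1 / 8 : ℝ) ^ n * Γ.card) := by
          push_cast
          refine sum_le_sum fun t ht => ?_
          simp only [I1, mem_filter, mem_univ, true_and] at ht
          refine (hone t.1 t.2.1 t.2.2 ht.1 ht.2.1).trans ?_
          refine mul_le_mul_of_nonneg_right ?_ (by positivity)
          calc (9 / 10 : ℝ) ^ (t.2.1.card * t.2.2.card) ≤ (9 / 10 : ℝ) ^ (20 * n) :=
                pow_le_pow_of_le_one (by norm_num) (by norm_num) ht.2.2
            _ = ((9 / 10 : ℝ) ^ 20) ^ n := by rw [pow_mul]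
            _ ≤ _ := by apply pow_le_pow_left₀ <;> norm_num
      _ ≤ (p * 4 ^ n) * ((1 / 8 : ℝ) ^ n * Γ.card) := by
          rw [sum_const, nsmul_eq_mul]
          refine mul_le_mul_of_nonneg_right ?_ (by positivity)
          have : I1.card ≤ p * (2 ^ n * 2 ^ n) := by
            refine (card_filter_le _ _).trans (le_of_eq ?_)
            simp
          rw [← mul_pow] at this
          exact_mod_cast this
      _ = p * (4 * (1 / 8 : ℝ)) ^ n * Γ.card := by rw [mul_pow]; ring
      _ = _ := by norm_num
  have hc2 : ((I2.biUnion fun t => Γ.filter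
      (fun G => FewNonedges G (X t.1).toFinset {t.2})).card : ℝ) ≤
      p * n * (9 / 10) ^ k * Γ.card := by
    calc _ ≤ ((∑ t ∈ I2, (Γ.filter
            (fun G => FewNonedges G (X t.1).toFinset {t.2})).card : ℕ) : ℝ) := by
          exact_mod_cast card_biUnion_le
      _ ≤ ∑ t ∈ I2, ((9 / 10 : ℝ) ^ k * Γ.card) := by
          push_cast
          refine sum_le_sum fun t ht => ?_
          simp only [I2, mem_filter, mem_univ, true_and] at ht
          refine (hone t.1 (X t.1).toFinset {t.2} (by simp) (by simpa using ht)).trans ?_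
          refine mul_le_mul_of_nonneg_right ?_ (by positivity)
          refine pow_le_pow_of_le_one (by norm_num) (by norm_num) ?_
          rw [card_singleton, mul_one, ← Set.ncard_eq_toFinset_card']
          exact hk _
      _ ≤ (p * n) * ((9 / 10 : ℝ) ^ k * Γ.card) := by
          rw [sum_const, nsmul_eq_mul]
          refine mul_le_mul_of_nonneg_right ?_ (by positivity)
          have : I2.card ≤ p * n := by
            refine (card_filter_le _ _).trans (le_of_eq ?_)
            simp
          exact_mod_cast this
      _ = _ := by ring
  have h1 : ((Γ.filter (fun G => ¬ Typical G X)).card : ℝ) ≤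
      p * (1 / 2) ^ n * Γ.card + p * n * (9 / 10) ^ k * Γ.card := by
    refine le_trans ?_ (add_le_add hc1 hc2)
    exact_mod_cast (card_le_card hsub).trans (card_union_le _ _)
  refine h1.trans ?_
  rw [← add_mul]
  exact mul_le_mul_of_nonneg_right hn (by positivity)

/-- A part with few non-neighbours at every vertex sits inside a part of a typical partition. -/
theorem subset_part {p n : ℕ} (hp : 0 < p) (G : SimpleGraph (Fin n)) (X : Fin p → Set (Fin n))
    (hcov : (⋃ i, X i) = Set.univ) (hT : Typical G X)
    (hX : ∀ i, 20 * p * (X i).ncard ≤ 21 * n)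
    (Y : Finset (Fin n)) (hY : 19 * n ≤ 20 * p * Y.card) (hbig : 1000 * p ^ 3 ≤ n)
    (hdeg : ∀ v ∈ Y, 32 * (Y.filter (fun w => ¬ G.Adj v w)).card ≤ Y.card) :
    ∃ a, (Y : Set (Fin n)) ⊆ X a := by
  have hn : 0 < n := lt_of_lt_of_le (by positivity) hbig
  have hYpos : 0 < Y.card := by
    rcases Nat.eq_zero_or_pos Y.card with h | h
    · rw [h] at hY; omega
    · exact h
  -- pigeonhole
  have hpig : ∃ a : Fin p, Y.card ≤ p * (Y.filter (· ∈ X a)).card := by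
    by_contra hcon
    push Not at hcon
    have hle : Y.card ≤ ∑ a : Fin p, (Y.filter (· ∈ X a)).card := by
      refine le_trans (card_le_card ?_) card_biUnion_le
      intro x hx
      have : x ∈ ⋃ i, X i := by rw [hcov]; trivial
      obtain ⟨i, hi⟩ := Set.mem_iUnion.1 this
      simp only [mem_biUnion, mem_filter, mem_univ, true_and]
      exact ⟨i, hx, hi⟩
    have : Nonempty (Fin p) := ⟨⟨0, hp⟩⟩
    have hlt : ∑ a : Fin p, p * (Y.filter (· ∈ X a)).card < ∑ _a : Fin p, Y.card :=
      sum_lt_sum_of_nonempty univ_nonempty fun a _ => hcon a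
    rw [← mul_sum, sum_const, card_univ, Fintype.card_fin, smul_eq_mul] at hlt
    exact absurd (Nat.lt_of_mul_lt_mul_left hlt) (not_lt.2 hle)
  obtain ⟨a, ha⟩ := hpig
  refine ⟨a, ?_⟩
  set A := Y.filter (· ∈ X a) with hA
  set B := Y.filter (· ∉ X a) with hB
  have hABc : A.card + B.card = Y.card := card_filter_add_card_filter_not _
  have hAX : (A : Set (Fin n)) ⊆ X a := by
    intro x hx
    rw [hA, mem_coe, mem_filter] at hx
    exact hx.2
  have hBX : Disjoint (B : Set (Fin n)) (X a) := by
    rw [Set.disjoint_left]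
    intro x hx
    rw [hB, mem_coe, mem_filter] at hx
    exact hx.2
  have hApos : 0 < A.card := by
    rcases Nat.eq_zero_or_pos A.card with h | h
    · rw [h] at ha; omega
    · exact h
  have hBsmall : 8 * B.card ≤ Y.card := by
    by_cases hc : 20 * n ≤ A.card * B.card
    · have hnb := hT a A B hAX hBX (Or.inl hc)
      unfold FewNonedges at hnb
      push Not at hnb
      have hcount : ((A ×ˢ B).filter (fun e => ¬ G.Adj e.1 e.2)).card ≤
          ∑ u ∈ A, (Y.filter (fun w => ¬ G.Adj u w)).card := by
        rw [← card_sigma]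
        refine card_le_card_of_injOn (fun e => ⟨e.1, e.2⟩) ?_ ?_
        · intro e he
          simp only [hA, hB, coe_filter, mem_product, mem_filter, Set.mem_ofPred_eq] at he
          simp only [hA, coe_sigma, Set.mem_sigma_iff, coe_filter, Set.mem_ofPred_eq]
          tauto
        · rintro ⟨x, y⟩ _ ⟨x', y'⟩ _ h
          simpa using h
      have hsum : 32 * ∑ u ∈ A, (Y.filter (fun w => ¬ G.Adj u w)).card ≤ A.card * Y.card := by
        rw [mul_sum, ← smul_eq_mul A.card, ← sum_const]
        exact sum_le_sum fun u hu => hdeg u (mem_filter.1 hu).1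
      have : A.card * (8 * B.card) ≤ A.card * Y.card := by nlinarith
      exact Nat.le_of_mul_le_mul_left this hApos
    · push Not at hc
      by_contra hcon
      push Not at hcon
      -- |Y| ≤ p |A|, |Y| < 8 |B|
      have e1 : Y.card * Y.card ≤ (p * A.card) * (8 * B.card) := Nat.mul_le_mul ha hcon.le
      have e2 : Y.card * Y.card ≤ 160 * p * n := by nlinarith
      have e3 : (19 * n) * (19 * n) ≤ (20 * p * Y.card) * (20 * p * Y.card) := Nat.mul_le_mul hY hY
      have e4 : (361 * n) * n ≤ (64000 * p ^ 3) * n := by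
        calc _ = (19 * n) * (19 * n) := by ring
          _ ≤ _ := e3
          _ = 400 * p ^ 2 * (Y.card * Y.card) := by ring
          _ ≤ 400 * p ^ 2 * (160 * p * n) := Nat.mul_le_mul_left _ e2
          _ = _ := by ring
      have e5 := Nat.le_of_mul_le_mul_right e4 hn
      have : 0 < p ^ 3 := by positivity
      omega
  -- now single vertices
  intro v hv
  by_contra hvX
  have hvY : v ∈ Y := hv
  have hnb := hT a (X a).toFinset {v} (by simp) (by simpa using hvX) (Or.inr (by simp))
  unfold FewNonedges at hnb
  push Not at hnb
  rw [card_singleton, mul_one] at hnb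
  have hcount : (((X a).toFinset ×ˢ {v}).filter (fun e => ¬ G.Adj e.1 e.2)).card ≤
      (Y.filter (fun w => ¬ G.Adj v w)).card + ((X a).toFinset \ A).card := by
    refine le_trans ?_ (card_union_le _ _)
    refine card_le_card_of_injOn (fun e => e.1) ?_ ?_
    · rintro ⟨x, y⟩ he
      simp only [coe_filter, mem_product, mem_filter, Set.mem_ofPred_eq, mem_singleton,
        Set.mem_toFinset] at he
      obtain ⟨⟨hx, rfl⟩, hadj⟩ := he
      simp only [hA, coe_union, coe_sdiff, coe_filter, Set.mem_union, Set.mem_ofPred_eq, Set.mem_sdiff,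
        Set.coe_toFinset]
      rw [SimpleGraph.adj_comm] at hadj
      tauto
    · rintro ⟨x, y⟩ h1 ⟨x', y'⟩ h2 h
      simp only [coe_filter, mem_product, mem_filter, Set.mem_ofPred_eq, mem_singleton,
        Set.mem_toFinset] at h1 h2 h
      rw [h, h1.1.2, h2.1.2]
  have hsd : ((X a).toFinset \ A).card + A.card = (X a).toFinset.card := by
    refine card_sdiff_add_card_eq_card ?_
    intro x hx
    rw [Set.mem_toFinset]
    exact hAX hx
  have hd := hdeg v hvY
  have hXa := hX a
  rw [Set.ncard_eq_toFinset_card'] at hXa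
  set x := (X a).toFinset.card
  set y := Y.card
  -- 24 x > 27 y
  have hkey : 27 * y < 24 * x := by omega
  have : p * (27 * y) < p * (24 * x) := Nat.mul_lt_mul_of_pos_left hkey hp
  nlinarith

theorem card_partitions_le {p n : ℕ} (hp : 0 < p) (hn : 0 < n)
    (T : Finset (Fin p → Set (Fin n)))
    (hdisj : ∀ X ∈ T, ∀ i j : Fin p, i ≠ j → Disjoint (X i) (X j))
    (hcov : ∀ X ∈ T, (⋃ i, X i) = Set.univ)
    (hup : ∀ X ∈ T, ∀ i, 20 * p * (X i).ncard ≤ 21 * n)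
    (hlo : ∀ X ∈ T, ∀ i, 19 * n ≤ 20 * p * (X i).ncard)
    (hsub : ∀ X ∈ T, ∀ Y ∈ T, ∀ j : Fin p, j ≠ ⟨0, hp⟩ → ∃ a, Y j ⊆ X a) :
    T.card ≤ p ^ p := by
  rcases T.eq_empty_or_nonempty with rfl | ⟨X0, hX0⟩
  · simp
  let s : (Fin p → Set (Fin n)) → (Fin p → Fin p) := fun Y j =>
    if h : ∃ a, Y j ⊆ X0 a then h.choose else ⟨0, hp⟩
  have hs : ∀ Y ∈ T, ∀ j : Fin p, j ≠ ⟨0, hp⟩ → Y j ⊆ X0 (s Y j) := by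
    intro Y hY j hj
    have h := hsub X0 hX0 Y hY j hj
    simp only [s, dif_pos h]
    exact h.choose_spec
  have hhalf : ∀ Y ∈ T, ∀ Z ∈ T, s Y = s Z → ∀ j : Fin p, j ≠ ⟨0, hp⟩ → Y j ⊆ Z j := by
    intro Y hY Z hZ hYZ j hj
    have h1 := hs Y hY j hj
    have h2 := hs Z hZ j hj
    rw [← hYZ] at h2
    have hint : (Y j ∩ Z j).Nonempty := by
      by_contra hcon
      rw [Set.not_nonempty_iff_eq_empty, ← Set.disjoint_iff_inter_eq_empty] at hcon
      have hu := Set.ncard_union_eq hcon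
      have hle : (Y j ∪ Z j).ncard ≤ (X0 (s Y j)).ncard :=
        Set.ncard_le_ncard (Set.union_subset h1 h2)
      rw [hu] at hle
      have a1 := hlo Y hY j
      have a2 := hlo Z hZ j
      have a3 := hup X0 hX0 (s Y j)
      have := Nat.mul_le_mul_left (20 * p) hle
      rw [mul_add] at this
      omega
    obtain ⟨a, ha⟩ := hsub Z hZ Y hY j hj
    obtain ⟨x, hxY, hxZ⟩ := hint
    by_cases haj : a = j
    · rwa [haj] at ha
    · exact absurd hxZ (Set.disjoint_left.1 (hdisj Z hZ a j haj) (ha hxY))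
  have hzero : ∀ Y ∈ T, Y ⟨0, hp⟩ = (⋃ j ∈ {j : Fin p | j ≠ ⟨0, hp⟩}, Y j)ᶜ := by
    intro Y hY
    ext x
    have hx : x ∈ ⋃ i, Y i := by rw [hcov Y hY]; trivial
    obtain ⟨i, hi⟩ := Set.mem_iUnion.1 hx
    simp only [Set.mem_compl_iff, Set.mem_iUnion, Set.mem_ofPred_eq, not_exists]
    constructor
    · intro h0 j hj hxj
      exact Set.disjoint_left.1 (hdisj Y hY j _ hj) hxj h0
    · intro h
      by_cases hi0 : i = ⟨0, hp⟩
      · rwa [hi0] at hi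
      · exact absurd hi (h i hi0)
  have hinj : Set.InjOn s (T : Set (Fin p → Set (Fin n))) := by
    intro Y hY Z hZ hYZ
    have heq : ∀ j : Fin p, j ≠ ⟨0, hp⟩ → Y j = Z j := fun j hj =>
      Set.Subset.antisymm (hhalf Y hY Z hZ hYZ j hj) (hhalf Z hZ Y hY hYZ.symm j hj)
    funext j
    by_cases hj : j = ⟨0, hp⟩
    · rw [hj, hzero Y hY, hzero Z hZ]
      congr 1
      exact Set.iUnion₂_congr heq
    · exact heq j hj
  have := card_le_card_of_injOn s (t := univ) (fun _ _ => by simp) hinj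
  simpa using this

/-- Translate the minimum degree condition into few non-neighbours. -/
theorem nonneighbors_le {n : ℕ} (G : SimpleGraph (Fin n)) (S : Set (Fin n))
    (h : ∀ v : S, 31 * (S.ncard : ℝ) / 32 + 1 ≤ (((G.induce S).neighborSet v).ncard : ℝ)) :
    ∀ v ∈ S.toFinset, 32 * (S.toFinset.filter (fun w => ¬ G.Adj v w)).card ≤ S.toFinset.card := by
  intro v hv
  have hvS : v ∈ S := Set.mem_toFinset.1 hv
  have hd := h ⟨v, hvS⟩
  have he : ((G.induce S).neighborSet ⟨v, hvS⟩).ncard =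
      (S.toFinset.filter (fun w => G.Adj v w)).card := by
    rw [← Set.ncard_image_of_injective _ Subtype.val_injective, ← Set.ncard_coe_finset]
    congr 1
    ext w
    simp
    tauto
  rw [he, Set.ncard_eq_toFinset_card'] at hd
  have hsum := card_filter_add_card_filter_not (s := S.toFinset) (fun w => G.Adj v w)
  have hsum' : ((S.toFinset.filter (fun w => G.Adj v w)).card : ℝ) +
      (S.toFinset.filter (fun w => ¬ G.Adj v w)).card = S.toFinset.card := by exact_mod_cast hsum
  have : (32 : ℝ) * (S.toFinset.filter (fun w => ¬ G.Adj v w)).card ≤ S.toFinset.card := by linarith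
  exact_mod_cast this

theorem eventually_consts (p l0 : ℕ) (hp : 0 < p) (μ : ℝ) (hμ : 0 < μ) :
    ∃ n0 : ℕ, ∀ n : ℕ, n0 ≤ n → 0 < n ∧ 1000 * p ^ 3 ≤ n ∧ l0 ≤ n / (2 * p) ∧
      (n : ℝ) ^ (1 - μ) ≤ n / (20 * p) ∧
      (p : ℝ) * (1 / 2) ^ n + p * n * (9 / 10) ^ (n / (2 * p)) ≤ 1 / 2 := by
  have hp' : (0 : ℝ) < p := by exact_mod_cast hp
  have hdiv : Tendsto (fun n : ℕ => n / (2 * p)) atTop atTop :=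
    Nat.tendsto_div_const_atTop (by omega)
  have e1 : ∀ᶠ n : ℕ in atTop, 0 < n := eventually_gt_atTop 0
  have e2 : ∀ᶠ n : ℕ in atTop, 1000 * p ^ 3 ≤ n := eventually_ge_atTop _
  have e3 : ∀ᶠ n : ℕ in atTop, l0 ≤ n / (2 * p) := hdiv.eventually (eventually_ge_atTop l0)
  have e4 : ∀ᶠ n : ℕ in atTop, (n : ℝ) ^ (-μ) < 1 / (20 * p) := by
    have := (tendsto_rpow_neg_atTop hμ).comp (tendsto_natCast_atTop_atTop (R := ℝ))
    exact this.eventually (gt_mem_nhds (by positivity))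
  have e5 : ∀ᶠ n : ℕ in atTop, (p : ℝ) * (1 / 2) ^ n < 1 / 4 := by
    have h : Tendsto (fun n : ℕ => (p : ℝ) * (1 / 2) ^ n) atTop (nhds (p * 0)) :=
      (tendsto_pow_atTop_nhds_zero_of_lt_one (by norm_num) (by norm_num)).const_mul _
    rw [mul_zero] at h
    exact h.eventually (gt_mem_nhds (by norm_num))
  have e6 : ∀ᶠ k : ℕ in atTop, (p : ℝ) * (2 * p * (k + 1)) * (9 / 10) ^ k < 1 / 4 := by
    have h1 : Tendsto (fun k : ℕ => (k : ℝ) * (9 / 10) ^ k) atTop (nhds 0) :=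
      tendsto_self_mul_const_pow_of_lt_one (by norm_num) (by norm_num)
    have h2 : Tendsto (fun k : ℕ => (9 / 10 : ℝ) ^ k) atTop (nhds 0) :=
      tendsto_pow_atTop_nhds_zero_of_lt_one (by norm_num) (by norm_num)
    have h := (h1.add h2).const_mul ((p : ℝ) * (2 * p))
    rw [add_zero, mul_zero] at h
    refine (h.eventually (gt_mem_nhds (show (0 : ℝ) < 1 / 4 by norm_num))).mono fun k hk => ?_
    refine lt_of_le_of_lt (le_of_eq ?_) hk
    ring
  have e7 := hdiv.eventually e6
  obtain ⟨n0, h0⟩ := eventually_atTop.1 (e1.and (e2.and (e3.and (e4.and (e5.and e7)))))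
  refine ⟨n0, fun n hn => ?_⟩
  obtain ⟨a1, a2, a3, a4, a5, a6⟩ := h0 n hn
  have hnR : (0 : ℝ) < n := by exact_mod_cast a1
  refine ⟨a1, a2, a3, ?_, ?_⟩
  · rw [show (1 - μ) = 1 + -μ by ring, Real.rpow_add hnR, Real.rpow_one, div_eq_mul_one_div]
    exact mul_le_mul_of_nonneg_left a4.le hnR.le
  · set k := n / (2 * p) with hk
    have hnk : n ≤ 2 * p * (k + 1) := by
      have := Nat.lt_mul_div_succ n (show 0 < 2 * p by omega)
      exact this.le
    have hnk' : (n : ℝ) ≤ 2 * p * (k + 1) := by exact_mod_cast hnk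
    have : (p : ℝ) * n * (9 / 10) ^ k ≤ p * (2 * p * (k + 1)) * (9 / 10) ^ k := by gcongr
    linarith

theorem GoodPair.sizes {p : ℕ} (hp : 0 < p) {F : Fin p → GraphClass} {μ : ℝ} {n : ℕ}
    {G : SimpleGraph (Fin n)} {X : Fin p → Set (Fin n)} (h : GoodPair F μ G X)
    (hn : (n : ℝ) ^ (1 - μ) ≤ n / (20 * p)) (i : Fin p) :
    20 * p * (X i).ncard ≤ 21 * n ∧ 19 * n ≤ 20 * p * (X i).ncard := by
  have hp' : (0 : ℝ) < p := by exact_mod_cast hp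
  have h4 := (h.2.2.2 i).trans_le hn
  rw [abs_lt] at h4
  obtain ⟨ha, hb⟩ := h4
  have e : (n : ℝ) / p * (20 * p) = 20 * n := by field_simp
  have e' : (n : ℝ) / (20 * p) * (20 * p) = n := by field_simp
  have h20 : (0 : ℝ) < 20 * p := by positivity
  have ha' := mul_lt_mul_of_pos_right ha h20
  have hb' := mul_lt_mul_of_pos_right hb h20
  rw [neg_mul, sub_mul, e, e'] at ha'
  rw [sub_mul, e, e'] at hb'
  constructor
  · have : (20 * p * (X i).ncard : ℝ) ≤ 21 * n := by linarith
    exact_mod_cast this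
  · have : (19 * n : ℝ) ≤ 20 * p * (X i).ncard := by linarith
    exact_mod_cast this

end Aux

/-- Claim on counting good (graph, partition) pairs: if every graph in `F 0` is
`P₄`-free or has girth at least 5, and for `i > 0` all large graphs in `F i` have
minimum degree at least `31l/32 + 1`, then for every `μ > 0` the number of good
(graph, partition) pairs is within a constant factor of the number of graphs
admitting at least one good partition. -/
theorem stmt_19 (p : ℕ) (hp : 0 < p)
    (F : Fin p → GraphClass)
    (hiso : ∀ (i : Fin p) (V W : Type) [Finite V] [Finite W]
      (G : SimpleGraph V) (G' : SimpleGraph W),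
        Nonempty (G ≃g G') → F i V G → F i W G')
    (h1 : ∀ (V : Type) [Finite V] (G : SimpleGraph V),
      F ⟨0, hp⟩ V G → (IndFree (SimpleGraph.pathGraph 4) G ∨ GirthAtLeastFive G))
    (h2 : ∃ l0 : ℕ, ∀ i : Fin p, i ≠ ⟨0, hp⟩ →
      ∀ (V : Type) [Finite V] (G : SimpleGraph V) (l : ℕ),
        Nat.card V = l → l0 ≤ l → F i V G →
          ∀ v : V, 31 * (l : ℝ) / 32 + 1 ≤ ((G.neighborSet v).ncard : ℝ)) :
    ∀ μ : ℝ, 0 < μ →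
      ∃ (C : ℝ) (n0 : ℕ), ∀ n : ℕ, n0 ≤ n →
        (({G : SimpleGraph (Fin n) |
            ∃ X : Fin p → Set (Fin n), GoodPair F μ G X}.ncard : ℝ) ≤
          (Nat.card {GX : SimpleGraph (Fin n) × (Fin p → Set (Fin n)) //
            GoodPair F μ GX.1 GX.2} : ℝ)) ∧
        ((Nat.card {GX : SimpleGraph (Fin n) × (Fin p → Set (Fin n)) //
            GoodPair F μ GX.1 GX.2} : ℝ) ≤
          C * ({G : SimpleGraph (Fin n) |
            ∃ X : Fin p → Set (Fin n), GoodPair F μ G X}.ncard : ℝ)) := by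
  classical
  intro μ hμ
  obtain ⟨l0, h2⟩ := h2
  obtain ⟨n0, hn0⟩ := eventually_consts p l0 hp μ hμ
  refine ⟨2 * (p : ℝ) ^ p, n0, fun n hn => ?_⟩
  obtain ⟨hnpos, hbig, hl0, hdev, hsmall⟩ := hn0 n hn
  -- everything as finsets
  let P : Finset (SimpleGraph (Fin n) × (Fin p → Set (Fin n))) :=
    Finset.univ.filter fun GX => GoodPair F μ GX.1 GX.2
  let Q : Finset (SimpleGraph (Fin n)) :=
    Finset.univ.filter fun G => ∃ X : Fin p → Set (Fin n), GoodPair F μ G X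
  have hP : Nat.card {GX : SimpleGraph (Fin n) × (Fin p → Set (Fin n)) //
      GoodPair F μ GX.1 GX.2} = P.card := by
    rw [Nat.card_eq_fintype_card, Fintype.card_subtype]
  have hQ : {G : SimpleGraph (Fin n) |
      ∃ X : Fin p → Set (Fin n), GoodPair F μ G X}.ncard = Q.card := by
    rw [← Set.ncard_coe_finset]
    congr 1
    ext G
    simp [Q]
  rw [hP, hQ]
  constructor
  · have hle : Q.card ≤ P.card := by
      refine (Finset.card_le_card (t := P.image Prod.fst) ?_).trans Finset.card_image_le
      intro G hG
      obtain ⟨X, hX⟩ := (Finset.mem_filter.1 hG).2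
      exact Finset.mem_image.2 ⟨(G, X), by simp [P, hX], rfl⟩
    exact_mod_cast hle
  -- the upper bound
  let Tp : Finset (SimpleGraph (Fin n) × (Fin p → Set (Fin n))) :=
    P.filter fun GX => Typical GX.1 GX.2
  have hhalf : (P.card : ℝ) ≤ 2 * Tp.card := by
    let Γ : (Fin p → Set (Fin n)) → Finset (SimpleGraph (Fin n)) := fun X =>
      Finset.univ.filter fun G => GoodPair F μ G X
    have hcP : P.card = ∑ X : Fin p → Set (Fin n), (Γ X).card := by
      rw [Finset.card_eq_sum_card_fiberwise (f := Prod.snd) (t := Finset.univ) (by simp)]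
      refine Finset.sum_congr rfl fun X _ => ?_
      refine Finset.card_bij' (fun GX _ => GX.1) (fun G _ => (G, X)) ?_ ?_ ?_ ?_
      · rintro ⟨G, Y⟩ h
        simp only [P, Finset.mem_filter, Finset.mem_univ, true_and] at h
        obtain ⟨h, rfl⟩ := h
        simpa [Γ] using h
      · intro G h
        simpa [Γ, P] using h
      · rintro ⟨G, Y⟩ h
        simp only [Finset.mem_filter] at h
        rw [h.2]
      · intro G h; rfl
    have hcT : Tp.card = ∑ X : Fin p → Set (Fin n),
        ((Γ X).filter fun G => Typical G X).card := by
      rw [Finset.card_eq_sum_card_fiberwise (f := Prod.snd) (t := Finset.univ) (by simp)]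
      refine Finset.sum_congr rfl fun X _ => ?_
      refine Finset.card_bij' (fun GX _ => GX.1) (fun G _ => (G, X)) ?_ ?_ ?_ ?_
      · rintro ⟨G, Y⟩ h
        simp only [Tp, P, Finset.mem_filter, Finset.mem_univ, true_and] at h
        obtain ⟨h, rfl⟩ := h
        simpa [Γ] using h
      · intro G h
        simpa [Γ, P, Tp] using h
      · rintro ⟨G, Y⟩ h
        simp only [Finset.mem_filter] at h
        rw [h.2]
      · intro G h; rfl
    rw [hcP, hcT]
    push_cast
    rw [Finset.mul_sum]
    refine Finset.sum_le_sum fun X _ => ?_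
    rcases (Γ X).eq_empty_or_nonempty with he | ⟨G0, hG0⟩
    · simp [he]
    have hG0' : GoodPair F μ G0 X := (Finset.mem_filter.1 hG0).2
    have hk : ∀ i, n / (2 * p) ≤ (X i).ncard := by
      intro i
      have h := (hG0'.sizes hp hdev i).2
      refine Nat.div_le_of_le_mul ?_
      nlinarith
    have hb := card_not_typical F μ X (n / (2 * p)) hk hsmall (Γ X) (by simp [Γ])
    have hs := Finset.card_filter_add_card_filter_not (s := Γ X) (fun G => Typical G X)
    have hs' : (((Γ X).filter fun G => Typical G X).card : ℝ) +
        ((Γ X).filter fun G => ¬ Typical G X).card = (Γ X).card := by exact_mod_cast hs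
    linarith
  have hmult : Tp.card ≤ p ^ p * Q.card := by
    refine Finset.card_le_mul_card_image_of_maps_to (f := Prod.fst) ?_ _ ?_
    · rintro ⟨G, X⟩ h
      simp only [Tp, P, Finset.mem_filter, Finset.mem_univ, true_and] at h
      simp only [Q, Finset.mem_filter, Finset.mem_univ, true_and]
      exact ⟨X, h.1⟩
    · intro G _
      let T : Finset (Fin p → Set (Fin n)) :=
        Finset.univ.filter fun X => GoodPair F μ G X ∧ Typical G X
      have hT : ∀ X ∈ T, GoodPair F μ G X ∧ Typical G X := fun X hX => (Finset.mem_filter.1 hX).2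
      have hle : (Tp.filter fun GX => GX.1 = G).card ≤ T.card := by
        refine Finset.card_le_card_of_injOn Prod.snd ?_ ?_
        · rintro ⟨G', X⟩ h
          simp only [Tp, P, Finset.mem_filter, Finset.mem_univ, true_and, Finset.mem_coe] at h
          obtain ⟨h, rfl⟩ := h
          simpa [T] using h
        · rintro ⟨G1, X1⟩ h1' ⟨G2, X2⟩ h2' h
          simp only [Finset.mem_filter, Finset.mem_coe] at h1' h2' h
          rw [h1'.2, h2'.2, h]
      refine hle.trans ?_
      refine card_partitions_le hp hnpos T (fun X hX => (hT X hX).1.1) (fun X hX => (hT X hX).1.2.1)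
        (fun X hX i => ((hT X hX).1.sizes hp hdev i).1)
        (fun X hX i => ((hT X hX).1.sizes hp hdev i).2) ?_
      intro X hX Y hY j hj
      have hYs := ((hT Y hY).1.sizes hp hdev j).2
      have hYl : l0 ≤ (Y j).ncard := by
        refine hl0.trans (Nat.div_le_of_le_mul ?_)
        nlinarith
      have hdeg := h2 j hj ↥(Y j) (G.induce (Y j)) (Y j).ncard (Nat.card_coe_set_eq _) hYl
        ((hT Y hY).1.2.2.1 j)
      have hnon := nonneighbors_le G (Y j) hdeg
      obtain ⟨a, ha⟩ := subset_part hp G X (hT X hX).1.2.1 (hT X hX).2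
        (fun i => ((hT X hX).1.sizes hp hdev i).1) (Y j).toFinset
        (by rw [← Set.ncard_eq_toFinset_card']; exact hYs) hbig (by convert hnon)
      exact ⟨a, by simpa using ha⟩
  have hmult' : (Tp.card : ℝ) ≤ (p : ℝ) ^ p * Q.card := by exact_mod_cast hmult
  linarith
end
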